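/- arXiv:0711.1937 — 2 statements merged into one kernel-verified Lean document; each statement's English description precedes it below -/
import Mathlib

section
/- Let s ≥ 2. Then for 1 ≤ i ≤ s, 8·Γ_i^{[s,s]×i} = 2^{2s+2i+1} − 3·2^{3i−1} + 2^{2i}, and for s+1 ≤ i ≤ 2s, Γ_i^{[s,s]×i} = 2^{2s+2i−2} − 3·2^{3i−4} + 2^{4i−2s−5}. -/
open Matrix

/-- The `a × k` Hankel (persymmetric) matrix over `F_2` whose `(i,j)` entry is `α (i+j)`. -/
def hankel (a k : ℕ) (α : Fin (a + k - 1) → ZMod 2) :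
    Matrix (Fin a) (Fin k) (ZMod 2) :=
  Matrix.of fun i j => α ⟨(i : ℕ) + (j : ℕ), by have := i.isLt; have := j.isLt; omega⟩

/-- `Γ_i^{[a,b]×k}` : the number of pairs `(α, β)` such that the `(a+b) × k` matrix obtained
by stacking the `a × k` Hankel matrix of `α` on top of the `b × k` Hankel matrix of `β`
has rank `i` over `F_2`. -/
noncomputable def Gamma (a b k i : ℕ) : ℕ :=
  Nat.card {p : (Fin (a + k - 1) → ZMod 2) × (Fin (b + k - 1) → ZMod 2) //
    (Matrix.fromRows (hankel a k p.1) (hankel b k p.2)).rank = i}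

open Polynomial

/-- Triples of binary polynomials. -/
abbrev PolyTriple := (ZMod 2)[X] × (ZMod 2)[X] × (ZMod 2)[X]

/-- A triple of polynomials is primitive when its entries generate the unit ideal. -/
def IsPrimitiveTriple (t : PolyTriple) : Prop :=
  ∃ x y z, x * t.1 + y * t.2.1 + z * t.2.2 = 1

theorem ZMod.two_eq_one_of_ne_zero {a : ZMod 2} (h : a ≠ 0) : a = 1 := by
  revert a; decide

theorem monic_of_ne_zero_zmod_two {p : (ZMod 2)[X]} (h : p ≠ 0) : p.Monic :=
  ZMod.two_eq_one_of_ne_zero (leadingCoeff_ne_zero.mpr h)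

theorem exists_eq_smul_isPrimitiveTriple {t : PolyTriple} (ht : t ≠ 0) :
    ∃ c : (ZMod 2)[X], c ≠ 0 ∧ ∃ p, IsPrimitiveTriple p ∧ t = c • p := by
  obtain ⟨a, b, e⟩ := t
  obtain ⟨c, hc⟩ := (IsPrincipalIdealRing.principal (Ideal.span {a, b, e})).principal
  have hmem : ∀ y ∈ ({a, b, e} : Set (ZMod 2)[X]), c ∣ y := fun y hy => by
    have := Ideal.subset_span hy
    rw [hc] at this
    exact Ideal.mem_span_singleton.mp this
  obtain ⟨a', rfl⟩ := hmem a (by simp)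
  obtain ⟨b', rfl⟩ := hmem b (by simp)
  obtain ⟨e', rfl⟩ := hmem e (by simp)
  have hc0 : c ≠ 0 := by
    rintro rfl
    simp at ht
  refine ⟨c, hc0, (a', b', e'), ?_, by simp⟩
  have : c ∈ Ideal.span {c * a', c * b', c * e'} := by
    rw [hc]; exact Ideal.mem_span_singleton_self c
  rw [Ideal.mem_span_insert] at this
  obtain ⟨x, w, hw, h⟩ := this
  obtain ⟨y, z, rfl⟩ := Ideal.mem_span_pair.mp hw
  refine ⟨x, y, z, mul_left_cancel₀ hc0 ?_⟩
  linear_combination -h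

theorem IsPrimitiveTriple.dvd_of_smul_eq {p q : PolyTriple} (hp : IsPrimitiveTriple p)
    {c d : (ZMod 2)[X]} (h : c • p = d • q) : d ∣ c := by
  obtain ⟨x, y, z, hxyz⟩ := hp
  obtain ⟨p1, p2, p3⟩ := p
  obtain ⟨q1, q2, q3⟩ := q
  simp only [Prod.smul_mk, smul_eq_mul, Prod.mk.injEq] at h
  obtain ⟨h1, h2, h3⟩ := h
  refine ⟨x * q1 + y * q2 + z * q3, ?_⟩
  linear_combination (-c) * hxyz + x * h1 + y * h2 + z * h3

theorem IsPrimitiveTriple.eq_of_smul_eq {p q : PolyTriple} (hp : IsPrimitiveTriple p)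
    (hq : IsPrimitiveTriple q) {c d : (ZMod 2)[X]} (hc : c ≠ 0) (hd : d ≠ 0)
    (h : c • p = d • q) : c = d ∧ p = q := by
  have hcd : c = d := eq_of_monic_of_associated (monic_of_ne_zero_zmod_two hc)
    (monic_of_ne_zero_zmod_two hd)
    (associated_of_dvd_dvd (hq.dvd_of_smul_eq h.symm) (hp.dvd_of_smul_eq h))
  subst hcd
  exact ⟨rfl, smul_right_injective _ hc h⟩

theorem IsPrimitiveTriple.smul_iff {p : PolyTriple} (hp : IsPrimitiveTriple p)
    {c : (ZMod 2)[X]} (hc : c ≠ 0) : IsPrimitiveTriple (c • p) ↔ c = 1 := by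
  constructor
  · intro h
    exact (hp.eq_of_smul_eq h hc one_ne_zero (by simp)).1
  · rintro rfl
    simpa using hp

/-- The content and the primitive part of a nonzero triple give a bijection between the
imprimitive elements of level `k + 1` and two copies of the elements of level `k`. -/
theorem ncard_level_succ {W : Set PolyTriple} {l : PolyTriple → ℕ} (h0 : ∀ t ∈ W, t ≠ 0)
    (hW : ∀ c : (ZMod 2)[X], c ≠ 0 → ∀ p, c • p ∈ W ↔ p ∈ W)
    (hl : ∀ c : (ZMod 2)[X], c ≠ 0 → ∀ p ∈ W, l (c • p) = c.natDegree + l p) (k : ℕ)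
    (hfin : {t ∈ W | l t = k + 1}.Finite) :
    {t ∈ W | l t = k + 1}.ncard =
      {t ∈ W | l t = k + 1 ∧ IsPrimitiveTriple t}.ncard + 2 * {t ∈ W | l t = k}.ncard := by
  have hdec : ∀ t : W, ∃ c : (ZMod 2)[X], c ≠ 0 ∧ ∃ p, IsPrimitiveTriple p ∧ t.1 = c • p :=
    fun t => exists_eq_smul_isPrimitiveTriple (h0 t t.2)
  choose c hc p hp ht using hdec
  have hpW : ∀ t, p t ∈ W := fun t => by
    have := t.2
    rw [ht t] at this
    exact (hW _ (hc t) _).mp this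
  have hlt : ∀ t, l t.1 = (c t).natDegree + l (p t) := fun t => by
    rw [← hl _ (hc t) _ (hpW t), ← ht t]
  have hX : ∀ (a : (ZMod 2)[X]) (b : ZMod 2), a ≠ 0 →
      a * X + C b ≠ 0 ∧ (a * X + C b).natDegree = a.natDegree + 1 := fun a b ha => by
    have : (a * X + C b).natDegree = a.natDegree + 1 := by
      rw [natDegree_add_C, natDegree_mul_X ha]
    refine ⟨fun h => ?_, this⟩
    rw [h] at this
    simp at this
  have key : {t ∈ W | l t = k + 1 ∧ ¬ IsPrimitiveTriple t}.ncard =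
      ({t ∈ W | l t = k} ×ˢ (Set.univ : Set (ZMod 2))).ncard := by
    symm
    refine Set.ncard_congr (fun x hx => (c ⟨x.1, hx.1.1⟩ * X + C x.2) • p ⟨x.1, hx.1.1⟩) ?_ ?_ ?_
    · rintro ⟨t, b⟩ ⟨⟨htW, htl⟩, -⟩
      obtain ⟨hn, hd⟩ := hX (c ⟨t, htW⟩) b (hc _)
      refine ⟨(hW _ hn _).mpr (hpW _), ?_, ?_⟩
      · dsimp only at *
        have := hlt ⟨t, htW⟩
        dsimp only at this htl
        rw [hl _ hn _ (hpW _), hd]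
        omega
      · dsimp only at *
        rw [(hp _).smul_iff hn]
        intro h
        rw [h] at hd
        simp at hd
    · rintro ⟨t, b⟩ ⟨t', b'⟩ ⟨⟨htW, htl⟩, _⟩ ⟨⟨htW', htl'⟩, _⟩ h
      obtain ⟨h1, h2⟩ := (hp ⟨t, htW⟩).eq_of_smul_eq (hp ⟨t', htW'⟩)
        (hX _ _ (hc _)).1 (hX _ _ (hc _)).1 h
      dsimp only at h1
      have hb : b = b' := by simpa using congrArg (fun q => coeff q 0) h1
      have hcc : c ⟨t, htW⟩ = c ⟨t', htW'⟩ := by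
        rw [hb] at h1
        exact mul_right_cancel₀ X_ne_zero (add_right_cancel h1)
      have e1 := ht ⟨t, htW⟩
      have e2 := ht ⟨t', htW'⟩
      dsimp only at e1 e2
      rw [e1, e2, hcc, h2, hb]
    · rintro t ⟨htW, htl, htp⟩
      have hd : (c ⟨t, htW⟩).natDegree ≠ 0 := fun h => by
        have h1 : c ⟨t, htW⟩ = 1 := (monic_of_ne_zero_zmod_two (hc _)).natDegree_eq_zero.mp h
        have e1 := ht ⟨t, htW⟩
        rw [h1, one_smul] at e1
        dsimp only at e1
        rw [e1] at htp
        exact htp (hp _)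
      have hdiv : (c ⟨t, htW⟩).divX ≠ 0 := fun h => by
        have := divX_mul_X_add (c ⟨t, htW⟩)
        rw [h, zero_mul, zero_add] at this
        rw [← this] at hd
        simp at hd
      have hmem : (c ⟨t, htW⟩).divX • p ⟨t, htW⟩ ∈ W := (hW _ hdiv _).mpr (hpW _)
      obtain ⟨e1, e2⟩ := (hp ⟨_, hmem⟩).eq_of_smul_eq (hp ⟨t, htW⟩) (hc _) hdiv (ht ⟨_, hmem⟩).symm
      refine ⟨((c ⟨t, htW⟩).divX • p ⟨t, htW⟩, (c ⟨t, htW⟩).coeff 0), ⟨⟨hmem, ?_⟩, trivial⟩, ?_⟩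
      · dsimp only
        rw [hl _ hdiv _ (hpW _), natDegree_divX_eq_natDegree_tsub_one]
        have := hlt ⟨t, htW⟩
        dsimp only at this
        omega
      · dsimp only
        rw [e1, e2, divX_mul_X_add]
        exact (ht ⟨t, htW⟩).symm
  rw [Set.ncard_prod, Set.ncard_univ, Nat.card_zmod] at key
  rw [mul_comm 2, ← key, ← Set.ncard_union_eq _ (hfin.subset fun t h => ⟨h.1, h.2.1⟩)
    (hfin.subset fun t h => ⟨h.1, h.2.1⟩)]
  · congr 1
    ext t
    simp only [Set.mem_ofPred_eq, Set.mem_union]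
    tauto
  · rw [Set.disjoint_left]
    rintro t ⟨-, -, h⟩ ⟨-, -, h'⟩
    exact h' h

theorem card_degreeLT_zmod_two (n : ℕ) : Nat.card (degreeLT (ZMod 2) n) = 2 ^ n := by
  rw [Nat.card_congr (degreeLTEquiv (ZMod 2) n).toEquiv]
  simp

instance finite_degreeLT_zmod_two (n : ℕ) : Finite (degreeLT (ZMod 2) n) :=
  Finite.of_equiv _ (degreeLTEquiv (ZMod 2) n).toEquiv.symm

theorem ncard_degreeLT_zmod_two (n : ℕ) : (degreeLT (ZMod 2) n : Set (ZMod 2)[X]).ncard = 2 ^ n :=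
  card_degreeLT_zmod_two n

theorem finite_coe_degreeLT_zmod_two (n : ℕ) :
    (degreeLT (ZMod 2) n : Set (ZMod 2)[X]).Finite :=
  Set.finite_coe_iff.mp (finite_degreeLT_zmod_two n)

theorem mem_degreeLT_iff_natDegree {p : (ZMod 2)[X]} {n : ℕ} :
    p ∈ degreeLT (ZMod 2) n ↔ p = 0 ∨ p.natDegree < n := by
  rw [mem_degreeLT]
  by_cases hp : p = 0
  · simp [hp]
  · rw [degree_eq_natDegree hp]
    norm_cast
    simp [hp]

theorem degree_lt_degree_iff_mem_degreeLT {p q : (ZMod 2)[X]} (hq : q ≠ 0) :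
    p.degree < q.degree ↔ p ∈ degreeLT (ZMod 2) q.natDegree := by
  rw [mem_degreeLT, degree_eq_natDegree hq]

theorem mem_degreeLT_succ_diff {p : (ZMod 2)[X]} {n : ℕ} :
    p ∈ (degreeLT (ZMod 2) (n + 1) : Set (ZMod 2)[X]) \ degreeLT (ZMod 2) n ↔
      p ≠ 0 ∧ p.natDegree = n := by
  simp only [Set.mem_sdiff, SetLike.mem_coe, mem_degreeLT_iff_natDegree]
  by_cases hp : p = 0
  · simp [hp]
  · simp only [hp, false_or, true_and, not_false_eq_true, ne_eq]
    omega

theorem ncard_natDegree_eq (n : ℕ) : {p : (ZMod 2)[X] | p ≠ 0 ∧ p.natDegree = n}.ncard = 2 ^ n := by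
  have : {p : (ZMod 2)[X] | p ≠ 0 ∧ p.natDegree = n} =
      (degreeLT (ZMod 2) (n + 1) : Set (ZMod 2)[X]) \ degreeLT (ZMod 2) n :=
    Set.ext fun _ => mem_degreeLT_succ_diff.symm
  rw [this, Set.ncard_sdiff (degreeLT_mono n.le_succ) (finite_coe_degreeLT_zmod_two _), ncard_degreeLT_zmod_two,
    ncard_degreeLT_zmod_two, pow_succ]
  omega

/-- Triples `(P, u, v)` with `deg u, deg v < deg P`: a modulus with two residues. -/
def residueTriples : Set PolyTriple :=
  {t | t.2.1.degree < t.1.degree ∧ t.2.2.degree < t.1.degree}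

/-- The level of a relation triple `(f, g, Q)`. -/
noncomputable def relationLevel (t : PolyTriple) : ℕ :=
  max t.1.natDegree t.2.1.natDegree

/-- Triples `(f, g, Q)` with `(f, g) ≠ 0` and `deg Q < max (deg f) (deg g)`. -/
def relationTriples : Set PolyTriple :=
  {t | (t.1 ≠ 0 ∨ t.2.1 ≠ 0) ∧ t.2.2 ∈ degreeLT (ZMod 2) (relationLevel t)}

/-- `(f, g, Q)` is a relation of `(P, u, v)` when `f u + g v = Q P`. -/
def IsRelation (r t : PolyTriple) : Prop :=
  r.1 * t.2.1 + r.2.1 * t.2.2 = r.2.2 * t.1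

theorem ne_zero_of_mem_residueTriples {t : PolyTriple} (h : t ∈ residueTriples) : t.1 ≠ 0 := by
  rintro h0
  have := h.1
  simp [h0] at this

theorem residueTriples_level_iff {t : PolyTriple} {k : ℕ} :
    t ∈ residueTriples ∧ t.1.natDegree = k ↔ (t.1 ≠ 0 ∧ t.1.natDegree = k) ∧
      t.2.1 ∈ degreeLT (ZMod 2) k ∧ t.2.2 ∈ degreeLT (ZMod 2) k := by
  constructor
  · rintro ⟨h, rfl⟩
    have h0 := ne_zero_of_mem_residueTriples h
    exact ⟨⟨h0, rfl⟩, (degree_lt_degree_iff_mem_degreeLT h0).mp h.1,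
      (degree_lt_degree_iff_mem_degreeLT h0).mp h.2⟩
  · rintro ⟨⟨h0, rfl⟩, h1, h2⟩
    exact ⟨⟨(degree_lt_degree_iff_mem_degreeLT h0).mpr h1,
      (degree_lt_degree_iff_mem_degreeLT h0).mpr h2⟩, rfl⟩

theorem residueTriples_level_eq (k : ℕ) : {t ∈ residueTriples | t.1.natDegree = k} =
    {p : (ZMod 2)[X] | p ≠ 0 ∧ p.natDegree = k} ×ˢ
      ((degreeLT (ZMod 2) k : Set (ZMod 2)[X]) ×ˢ (degreeLT (ZMod 2) k : Set (ZMod 2)[X])) :=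
  Set.ext fun _ => residueTriples_level_iff

theorem finite_residueTriples_level (k : ℕ) : {t ∈ residueTriples | t.1.natDegree = k}.Finite := by
  rw [residueTriples_level_eq]
  refine Set.Finite.prod ?_ (Set.Finite.prod (finite_coe_degreeLT_zmod_two _) (finite_coe_degreeLT_zmod_two _))
  refine (finite_coe_degreeLT_zmod_two (k + 1)).subset fun p hp => ?_
  exact (mem_degreeLT_succ_diff.mpr hp).1

theorem ncard_residueTriples_level (k : ℕ) :
    {t ∈ residueTriples | t.1.natDegree = k}.ncard = 8 ^ k := by
  rw [residueTriples_level_eq, Set.ncard_prod, Set.ncard_prod, ncard_natDegree_eq,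
    ncard_degreeLT_zmod_two, ← mul_pow, ← mul_pow]
  norm_num

theorem relationTriples_level_iff {t : PolyTriple} {n : ℕ} :
    t ∈ relationTriples ∧ relationLevel t = n ↔
      ((t.1 ∈ degreeLT (ZMod 2) (n + 1) ∧ t.2.1 ∈ degreeLT (ZMod 2) (n + 1)) ∧
        ¬ (t.1 ∈ degreeLT (ZMod 2) n ∧ t.2.1 ∈ degreeLT (ZMod 2) n)) ∧
      t.2.2 ∈ degreeLT (ZMod 2) n := by
  obtain ⟨f, g, q⟩ := t
  simp only [relationTriples, relationLevel, Set.mem_ofPred_eq, mem_degreeLT_iff_natDegree]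
  by_cases hf : f = 0 <;> by_cases hg : g = 0 <;> by_cases hq : q = 0 <;>
    simp [hf, hg, hq] <;> omega

theorem relationTriples_level_eq (n : ℕ) : {t ∈ relationTriples | relationLevel t = n} =
    Equiv.prodAssoc _ _ _ '' ((((degreeLT (ZMod 2) (n + 1) : Set (ZMod 2)[X]) ×ˢ
      (degreeLT (ZMod 2) (n + 1) : Set (ZMod 2)[X])) \ ((degreeLT (ZMod 2) n : Set (ZMod 2)[X]) ×ˢ
      (degreeLT (ZMod 2) n : Set (ZMod 2)[X]))) ×ˢ (degreeLT (ZMod 2) n : Set (ZMod 2)[X])) := by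
  rw [Equiv.image_eq_preimage_symm]
  exact Set.ext fun _ => relationTriples_level_iff

theorem finite_relationTriples_level (n : ℕ) :
    {t ∈ relationTriples | relationLevel t = n}.Finite := by
  have h := finite_coe_degreeLT_zmod_two
  rw [relationTriples_level_eq]
  exact ((((h _).prod (h _)).sdiff).prod (h _)).image _

theorem ncard_relationTriples_level (n : ℕ) :
    {t ∈ relationTriples | relationLevel t = n}.ncard = 3 * 8 ^ n := by
  have h := finite_coe_degreeLT_zmod_two
  have hle : (degreeLT (ZMod 2) n : Set (ZMod 2)[X]) ⊆ degreeLT (ZMod 2) (n + 1) :=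
    degreeLT_mono n.le_succ
  rw [relationTriples_level_eq, Set.ncard_image_of_injective _ (Equiv.injective _),
    Set.ncard_prod, Set.ncard_sdiff (Set.prod_mono hle hle) ((h _).prod (h _))]
  simp only [Set.ncard_prod, ncard_degreeLT_zmod_two]
  have : (8 : ℕ) ^ n = 2 ^ n * 2 ^ n * 2 ^ n := by
    rw [← mul_pow, ← mul_pow]; norm_num
  rw [this, pow_succ]
  have : 2 ^ n * 2 * (2 ^ n * 2) - 2 ^ n * 2 ^ n = 3 * (2 ^ n * 2 ^ n) := by
    have : 2 ^ n * 2 * (2 ^ n * 2) = 4 * (2 ^ n * 2 ^ n) := by ring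
    omega
  rw [this]
  ring

theorem smul_mem_residueTriples_iff (c : (ZMod 2)[X]) (hc : c ≠ 0) (t : PolyTriple) :
    c • t ∈ residueTriples ↔ t ∈ residueTriples := by
  have h : ∀ p q : (ZMod 2)[X], (c * p).degree < (c * q).degree ↔ p.degree < q.degree := by
    intro p q
    rw [degree_mul, degree_mul, degree_eq_natDegree hc]
    exact WithBot.add_lt_add_iff_left (WithBot.coe_ne_bot)
  exact and_congr (h _ _) (h _ _)

theorem relationLevel_smul {c : (ZMod 2)[X]} (hc : c ≠ 0) {t : PolyTriple}
    (ht : t.1 ≠ 0 ∨ t.2.1 ≠ 0) : relationLevel (c • t) = c.natDegree + relationLevel t := by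
  obtain ⟨f, g, q⟩ := t
  simp only [relationLevel, Prod.smul_mk, smul_eq_mul]
  by_cases hf : f = 0 <;> by_cases hg : g = 0 <;> simp_all [natDegree_mul]

theorem smul_mem_relationTriples_iff (c : (ZMod 2)[X]) (hc : c ≠ 0) (t : PolyTriple) :
    c • t ∈ relationTriples ↔ t ∈ relationTriples := by
  have h0 : ((c • t).1 ≠ 0 ∨ (c • t).2.1 ≠ 0) ↔ (t.1 ≠ 0 ∨ t.2.1 ≠ 0) := by
    simp [hc]
  unfold relationTriples
  rw [Set.mem_ofPred_eq, Set.mem_ofPred_eq, h0]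
  refine and_congr_right fun ht => ?_
  rw [relationLevel_smul hc ht, mem_degreeLT_iff_natDegree, mem_degreeLT_iff_natDegree]
  by_cases hq : t.2.2 = 0
  · simp [hq]
  · have : (c • t).2.2.natDegree = c.natDegree + t.2.2.natDegree := natDegree_mul hc hq
    rw [this]
    simp [hc, hq]

theorem ncard_primitive_residueTriples_level (k : ℕ) :
    {t ∈ residueTriples | t.1.natDegree = k + 1 ∧ IsPrimitiveTriple t}.ncard = 6 * 8 ^ k := by
  have := ncard_level_succ (W := residueTriples) (l := fun t => t.1.natDegree)
    (fun t ht h => ne_zero_of_mem_residueTriples ht (by simp [h])) smul_mem_residueTriples_iff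
    (fun c hc p hp => natDegree_mul hc (ne_zero_of_mem_residueTriples hp)) k
    (finite_residueTriples_level _)
  rw [ncard_residueTriples_level, ncard_residueTriples_level] at this
  rw [pow_succ] at this
  omega

theorem ncard_primitive_relationTriples_level_zero :
    {t ∈ relationTriples | relationLevel t = 0 ∧ IsPrimitiveTriple t}.ncard = 3 := by
  refine Eq.trans ?_ ((ncard_relationTriples_level 0).trans (by norm_num))
  congr 1
  ext ⟨f, g, q⟩
  constructor
  · exact fun h => ⟨h.1, h.2.1⟩
  · rintro ⟨h, hl⟩
    refine ⟨h, hl, ?_⟩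
    have h1 : ∀ p : (ZMod 2)[X], p ≠ 0 → p.natDegree = 0 → p = 1 := fun p hp hd =>
      (monic_of_ne_zero_zmod_two hp).natDegree_eq_zero.mp hd
    simp only [relationLevel] at hl
    rcases h.1 with hf | hg
    · exact ⟨1, 0, 0, by simp [h1 f hf (by omega)]⟩
    · exact ⟨0, 1, 0, by simp [h1 g hg (by omega)]⟩

theorem ncard_primitive_relationTriples_level_succ (n : ℕ) :
    {t ∈ relationTriples | relationLevel t = n + 1 ∧ IsPrimitiveTriple t}.ncard = 18 * 8 ^ n := by
  have := ncard_level_succ (W := relationTriples) (l := relationLevel)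
    (fun t ht h => by simpa [h] using ht.1) smul_mem_relationTriples_iff
    (fun c hc p hp => relationLevel_smul hc hp.1) n
    (finite_relationTriples_level _)
  rw [ncard_relationTriples_level, ncard_relationTriples_level] at this
  rw [pow_succ] at this
  omega

theorem mul_mem_degreeLT_add {p q : (ZMod 2)[X]} {m n : ℕ} (hp : p ∈ degreeLT (ZMod 2) m)
    (hq : q ∈ degreeLT (ZMod 2) (n + 1)) : p * q ∈ degreeLT (ZMod 2) (m + n) := by
  rw [mem_degreeLT_iff_natDegree] at *
  by_cases hp0 : p = 0
  · simp [hp0]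
  by_cases hq0 : q = 0
  · simp [hq0]
  rw [natDegree_mul hp0 hq0]
  simp only [hp0, hq0, false_or] at hp hq
  omega

theorem mem_degreeLT_of_mul_mem {f p : (ZMod 2)[X]} {k : ℕ} (hf : f ≠ 0)
    (h : f * p ∈ degreeLT (ZMod 2) (f.natDegree + k)) : p ∈ degreeLT (ZMod 2) k := by
  rw [mem_degreeLT_iff_natDegree] at *
  by_cases hp : p = 0
  · simp [hp]
  rw [natDegree_mul hf hp] at h
  simp only [mul_eq_zero, hf, hp, or_self, false_or] at h
  omega

theorem modByMonic_mem_degreeLT {f : (ZMod 2)[X]} (hf : f ≠ 0) (p : (ZMod 2)[X]) :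
    p %ₘ f ∈ degreeLT (ZMod 2) f.natDegree :=
  (degree_lt_degree_iff_mem_degreeLT hf).mp (degree_modByMonic_lt p (monic_of_ne_zero_zmod_two hf))

/-- Pairs `(P, v)` of bounded degree with `f ∣ Q P + g v`. -/
def divisibilityPairs (f g q : (ZMod 2)[X]) (a b : ℕ) : Set ((ZMod 2)[X] × (ZMod 2)[X]) :=
  {x | (x.1 ∈ degreeLT (ZMod 2) a ∧ x.2 ∈ degreeLT (ZMod 2) b) ∧ f ∣ q * x.1 + g * x.2}

theorem finite_divisibilityPairs (f g q : (ZMod 2)[X]) (a b : ℕ) :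
    (divisibilityPairs f g q a b).Finite :=
  ((finite_coe_degreeLT_zmod_two a).prod (finite_coe_degreeLT_zmod_two b)).subset fun _ h => h.1

theorem ncard_divisibilityPairs {f g q : (ZMod 2)[X]} (hf : f ≠ 0)
    (hp : IsPrimitiveTriple (f, g, q)) {a b : ℕ} (ha : f.natDegree ≤ a) (hb : f.natDegree ≤ b) :
    (divisibilityPairs f g q a b).ncard * 2 ^ f.natDegree = 2 ^ a * 2 ^ b := by
  have hm := monic_of_ne_zero_zmod_two hf
  let φ : (degreeLT (ZMod 2) a × degreeLT (ZMod 2) b) →ₗ[ZMod 2] degreeLT (ZMod 2) f.natDegree :=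
    LinearMap.codRestrict _ ((modByMonicHom f).comp
      (((LinearMap.mulLeft (ZMod 2) q).comp (Submodule.subtype _)).coprod
        ((LinearMap.mulLeft (ZMod 2) g).comp (Submodule.subtype _))))
      fun x => modByMonic_mem_degreeLT hf _
  have hφ : ∀ x, (φ x : (ZMod 2)[X]) = (q * (x.1 : (ZMod 2)[X]) + g * (x.2 : (ZMod 2)[X])) %ₘ f := fun x => rfl
  have hsurj : Function.Surjective φ := by
    obtain ⟨x, y, z, h⟩ := hp
    rintro ⟨r, hr⟩
    refine ⟨(⟨(r * z) %ₘ f, degreeLT_mono ha (modByMonic_mem_degreeLT hf _)⟩,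
      ⟨(r * y) %ₘ f, degreeLT_mono hb (modByMonic_mem_degreeLT hf _)⟩), Subtype.ext ?_⟩
    rw [hφ]
    refine (div_modByMonic_unique (f := q * ((r * z) %ₘ f) + g * ((r * y) %ₘ f))
      (-(r * x) - q * ((r * z) /ₘ f) - g * ((r * y) /ₘ f)) r hm
      ⟨?_, (degree_lt_degree_iff_mem_degreeLT hf).mpr hr⟩).2
    have e1 := modByMonic_add_div (r * z) f
    have e2 := modByMonic_add_div (r * y) f
    dsimp only at h
    linear_combination (-r) * h - q * e1 - g * e2
  have hcard := Submodule.card_eq_card_quotient_mul_card (LinearMap.ker φ)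
  rw [Nat.card_congr (φ.quotKerEquivOfSurjective hsurj).toEquiv, Nat.card_prod,
    card_degreeLT_zmod_two, card_degreeLT_zmod_two, card_degreeLT_zmod_two] at hcard
  rw [hcard]
  congr 1
  refine (Nat.card_congr ?_).symm
  refine ⟨fun x => ⟨(x.1.1.1, x.1.2.1), ⟨x.1.1.2, x.1.2.2⟩, ?_⟩,
    fun x => ⟨(⟨x.1.1, x.2.1.1⟩, ⟨x.1.2, x.2.1.2⟩), ?_⟩, fun x => rfl, fun x => rfl⟩
  · have := congrArg Subtype.val (LinearMap.mem_ker.mp x.2)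
    rw [hφ] at this
    exact (modByMonic_eq_zero_iff_dvd hm).mp this
  · rw [LinearMap.mem_ker, Subtype.ext_iff, hφ]
    exact (modByMonic_eq_zero_iff_dvd hm).mpr x.2.2

theorem isRelation_iff {f g q P u v : (ZMod 2)[X]} :
    IsRelation (f, g, q) (P, u, v) ↔ q * P + g * v = f * u := by
  have h2 : (2 : (ZMod 2)[X]) = 0 := CharTwo.two_eq_zero
  simp only [IsRelation]
  constructor <;> intro h
  · linear_combination -h + g * v * h2
  · linear_combination -h + g * v * h2

theorem ncard_isRelation_of_ne_zero {f g q : (ZMod 2)[X]} (hf : f ≠ 0)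
    (hgf : g ∈ degreeLT (ZMod 2) (f.natDegree + 1)) (hq : q ∈ degreeLT (ZMod 2) f.natDegree)
    (hp : IsPrimitiveTriple (f, g, q)) {k : ℕ} (hk : f.natDegree ≤ k) :
    {t ∈ residueTriples | t.1.natDegree = k ∧ IsRelation (f, g, q) t}.ncard * 2 ^ f.natDegree =
      4 ^ k := by
  have hcongr : {t ∈ residueTriples | t.1.natDegree = k ∧ IsRelation (f, g, q) t}.ncard =
      (divisibilityPairs f g q (k + 1) k \ divisibilityPairs f g q k k).ncard := by
    refine Set.ncard_congr (fun t _ => (t.1, t.2.2)) ?_ ?_ ?_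
    · rintro ⟨P, u, v⟩ ⟨h, hd, hr⟩
      obtain ⟨hP, hu, hv⟩ := residueTriples_level_iff.mp ⟨h, hd⟩
      have hP' := mem_degreeLT_succ_diff.mpr hP
      exact ⟨⟨⟨hP'.1, hv⟩, ⟨u, isRelation_iff.mp hr⟩⟩, fun h => hP'.2 h.1.1⟩
    · rintro ⟨P, u, v⟩ ⟨P', u', v'⟩ ⟨_, _, hr⟩ ⟨_, _, hr'⟩ h
      obtain ⟨rfl, rfl⟩ := Prod.mk.inj h
      have := (isRelation_iff.mp hr).symm.trans (isRelation_iff.mp hr')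
      rw [mul_left_cancel₀ hf this]
    · rintro ⟨P, v⟩ ⟨⟨⟨hP, hv⟩, ⟨u, hu⟩⟩, hn⟩
      have hP' : P ≠ 0 ∧ P.natDegree = k :=
        mem_degreeLT_succ_diff.mp ⟨hP, fun h => hn ⟨⟨h, hv⟩, ⟨u, hu⟩⟩⟩
      have hu' : u ∈ degreeLT (ZMod 2) k := by
        refine mem_degreeLT_of_mul_mem hf ?_
        rw [← hu]
        refine Submodule.add_mem _ (mul_mem_degreeLT_add hq hP) ?_
        rw [mul_comm, add_comm]
        exact mul_mem_degreeLT_add hv hgf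
      obtain ⟨h1, h2⟩ := residueTriples_level_iff (t := (P, u, v)).mpr ⟨hP', hu', hv⟩
      exact ⟨(P, u, v), ⟨h1, h2, isRelation_iff.mpr hu⟩, rfl⟩
  have h1 := ncard_divisibilityPairs hf hp (a := k + 1) (b := k) (by omega) hk
  have h2 := ncard_divisibilityPairs hf hp (a := k) (b := k) hk hk
  have hsub : divisibilityPairs f g q k k ⊆ divisibilityPairs f g q (k + 1) k :=
    fun x h => ⟨⟨degreeLT_mono k.le_succ h.1.1, h.1.2⟩, h.2⟩
  rw [hcongr, Set.ncard_sdiff hsub (finite_divisibilityPairs ..), Nat.sub_mul, h1, h2, pow_succ]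
  have : (4 : ℕ) ^ k = 2 ^ k * 2 ^ k := by
    rw [← mul_pow]; norm_num
  rw [this]
  have : 2 ^ k * 2 * 2 ^ k = 2 * (2 ^ k * 2 ^ k) := by ring
  omega

theorem IsRelation.swap {f g q P u v : (ZMod 2)[X]} (h : IsRelation (f, g, q) (P, u, v)) :
    IsRelation (g, f, q) (P, v, u) := by
  simp only [IsRelation] at *
  rw [add_comm, h]

theorem IsPrimitiveTriple.swap {f g q : (ZMod 2)[X]} (h : IsPrimitiveTriple (f, g, q)) :
    IsPrimitiveTriple (g, f, q) := by
  obtain ⟨x, y, z, h⟩ := h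
  exact ⟨y, x, z, by rw [← h]; ring⟩

theorem ncard_isRelation_swap (f g q : (ZMod 2)[X]) (k : ℕ) :
    {t ∈ residueTriples | t.1.natDegree = k ∧ IsRelation (f, g, q) t}.ncard =
      {t ∈ residueTriples | t.1.natDegree = k ∧ IsRelation (g, f, q) t}.ncard := by
  refine Set.ncard_congr (fun t _ => (t.1, t.2.2, t.2.1)) ?_ ?_ ?_
  · rintro ⟨P, u, v⟩ ⟨h, hd, hr⟩
    exact ⟨⟨h.2, h.1⟩, hd, hr.swap⟩
  · rintro ⟨P, u, v⟩ ⟨P', u', v'⟩ _ _ h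
    simp only [Prod.mk.injEq] at h
    obtain ⟨rfl, rfl, rfl⟩ := h
    rfl
  · rintro ⟨P, u, v⟩ ⟨h, hd, hr⟩
    exact ⟨(P, v, u), ⟨⟨h.2, h.1⟩, hd, hr.swap⟩, rfl⟩

theorem ncard_isRelation {r : PolyTriple} (hr : r ∈ relationTriples) (hp : IsPrimitiveTriple r)
    {k : ℕ} (hk : relationLevel r ≤ k) :
    {t ∈ residueTriples | t.1.natDegree = k ∧ IsRelation r t}.ncard * 2 ^ relationLevel r =
      4 ^ k := by
  obtain ⟨f, g, q⟩ := r
  obtain ⟨h0, hq⟩ := hr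
  simp only [relationLevel] at *
  have aux : ∀ {f g : (ZMod 2)[X]}, (f ≠ 0 ∨ g ≠ 0) → g.natDegree ≤ f.natDegree → f = 0 →
      f.natDegree ≤ g.natDegree ∧ g ≠ 0 := by
    rintro f g h hle rfl
    simp_all
  rcases le_total g.natDegree f.natDegree with h | h
  · by_cases hf : f = 0
    · obtain ⟨h1, h2⟩ := aux h0 h hf
      rw [max_eq_right h1] at *
      rw [ncard_isRelation_swap]
      exact ncard_isRelation_of_ne_zero h2 (mem_degreeLT_iff_natDegree.mpr (by simp; omega))
        hq hp.swap hk
    · rw [max_eq_left h] at *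
      exact ncard_isRelation_of_ne_zero hf (mem_degreeLT_iff_natDegree.mpr (by simp; omega))
        hq hp hk
  · by_cases hg : g = 0
    · obtain ⟨h1, h2⟩ := aux h0.symm h hg
      rw [max_eq_left h1] at *
      exact ncard_isRelation_of_ne_zero h2 (mem_degreeLT_iff_natDegree.mpr (by simp; omega))
        hq hp hk
    · rw [max_eq_right h] at *
      rw [ncard_isRelation_swap]
      exact ncard_isRelation_of_ne_zero hg (mem_degreeLT_iff_natDegree.mpr (by simp; omega))
        hq hp.swap hk

theorem isRelation_smul_iff {c : (ZMod 2)[X]} (hc : c ≠ 0) (r t : PolyTriple) :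
    IsRelation r (c • t) ↔ IsRelation r t := by
  obtain ⟨P, u, v⟩ := t
  simp only [IsRelation, Prod.smul_mk, smul_eq_mul]
  constructor
  · intro h
    exact mul_left_cancel₀ hc (by linear_combination h)
  · intro h
    linear_combination c * h

theorem ncard_primitive_isRelation {r : PolyTriple} (hr : r ∈ relationTriples)
    (hp : IsPrimitiveTriple r) {k : ℕ} (hk : relationLevel r ≤ k) :
    {t ∈ residueTriples | t.1.natDegree = k + 1 ∧ IsPrimitiveTriple t ∧ IsRelation r t}.ncard *
      2 ^ relationLevel r = 2 * 4 ^ k := by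
  have h := ncard_level_succ (W := {t ∈ residueTriples | IsRelation r t})
    (l := fun t => t.1.natDegree)
    (fun t ht h => ne_zero_of_mem_residueTriples ht.1 (by simp [h]))
    (fun c hc p => and_congr (smul_mem_residueTriples_iff c hc p) (isRelation_smul_iff hc r p))
    (fun c hc p hp => natDegree_mul hc (ne_zero_of_mem_residueTriples hp.1)) k
    ((finite_residueTriples_level (k + 1)).subset fun t ht => ⟨ht.1.1, ht.2⟩)
  have e : ∀ A : PolyTriple → Prop, {t | t ∈ {t ∈ residueTriples | IsRelation r t} ∧ A t} =
      {t ∈ residueTriples | A t ∧ IsRelation r t} := fun A => by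
    ext t
    simp only [Set.mem_ofPred_eq]
    tauto
  simp only [e, and_assoc] at h
  have h1 := ncard_isRelation hr hp (k := k + 1) (by omega)
  have h2 := ncard_isRelation hr hp hk
  rw [h, add_mul, mul_assoc, h2, pow_succ] at h1
  omega

/-- `t = (P, u, v)` has a small relation of size `e` when `P ∣ f u + g v` for some nonzero pair
`(f, g)` of polynomials of degree less than `e`. -/
def HasSmallRelation (e : ℕ) (t : PolyTriple) : Prop :=
  ∃ f ∈ degreeLT (ZMod 2) e, ∃ g ∈ degreeLT (ZMod 2) e, (f ≠ 0 ∨ g ≠ 0) ∧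
    t.1 ∣ f * t.2.1 + g * t.2.2

theorem relationLevel_lt_iff {r : PolyTriple} (hr : r.1 ≠ 0 ∨ r.2.1 ≠ 0) {e : ℕ} :
    relationLevel r < e ↔ r.1 ∈ degreeLT (ZMod 2) e ∧ r.2.1 ∈ degreeLT (ZMod 2) e := by
  simp only [mem_degreeLT_iff_natDegree, relationLevel]
  by_cases h1 : r.1 = 0 <;> by_cases h2 : r.2.1 = 0 <;> simp_all

theorem hasSmallRelation_iff {e : ℕ} {t : PolyTriple} (ht : t ∈ residueTriples) :
    HasSmallRelation e t ↔
      ∃ r ∈ relationTriples, relationLevel r < e ∧ IsPrimitiveTriple r ∧ IsRelation r t := by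
  constructor
  · rintro ⟨f, hf, g, hg, h0, q, hq⟩
    have hP := ne_zero_of_mem_residueTriples ht
    obtain ⟨-, hu, hv⟩ := residueTriples_level_iff.mp ⟨ht, rfl⟩
    have hmem : (f, g, q) ∈ relationTriples := by
      refine ⟨h0, mem_degreeLT_of_mul_mem hP ?_⟩
      have hlt := (relationLevel_lt_iff (r := (f, g, q)) h0).mp (Nat.lt_succ_self _)
      rw [← hq, mul_comm f, mul_comm g]
      exact Submodule.add_mem _ (mul_mem_degreeLT_add hu hlt.1) (mul_mem_degreeLT_add hv hlt.2)
    have hlev : relationLevel (f, g, q) < e :=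
      (relationLevel_lt_iff (r := (f, g, q)) h0).mpr ⟨hf, hg⟩
    obtain ⟨c, hc, p, hp, h⟩ := exists_eq_smul_isPrimitiveTriple (t := (f, g, q)) (by
      rintro h; simp only [Prod.mk_eq_zero] at h; simp [h] at h0)
    rw [h] at hmem hlev
    have hp' := (smul_mem_relationTriples_iff c hc p).mp hmem
    rw [relationLevel_smul hc hp'.1] at hlev
    refine ⟨p, hp', by omega, hp, mul_left_cancel₀ hc ?_⟩
    obtain ⟨p1, p2, p3⟩ := p
    simp only [Prod.smul_mk, smul_eq_mul, Prod.mk.injEq] at h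
    obtain ⟨rfl, rfl, rfl⟩ := h
    linear_combination hq
  · rintro ⟨r, hr, hl, -, h⟩
    have := (relationLevel_lt_iff hr.1).mp hl
    exact ⟨r.1, this.1, r.2.1, this.2, hr.1, Dvd.intro_left _ h.symm⟩

theorem IsRelation.eq {t r r' : PolyTriple} (htp : IsPrimitiveTriple t)
    (hr : r ∈ relationTriples) (hr' : r' ∈ relationTriples)
    (hrp : IsPrimitiveTriple r) (hrp' : IsPrimitiveTriple r') (h : IsRelation r t)
    (h' : IsRelation r' t) (hl : relationLevel r + relationLevel r' < t.1.natDegree) : r = r' := by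
  have hf := (relationLevel_lt_iff hr.1).mp (Nat.lt_succ_self _)
  have hf' := (relationLevel_lt_iff hr'.1).mp (Nat.lt_succ_self _)
  obtain ⟨P, u, v⟩ := t
  obtain ⟨f, g, q⟩ := r
  obtain ⟨f', g', q'⟩ := r'
  obtain ⟨x, y, z, hxyz⟩ := htp
  obtain ⟨h0, -⟩ := hr
  obtain ⟨h0', -⟩ := hr'
  simp only [IsRelation] at *
  have e1 : (f * g' - f' * g) * u = P * (q * g' - q' * g) := by
    linear_combination g' * h - g * h'
  have e2 : (f * g' - f' * g) * v = P * (f * q' - f' * q) := by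
    linear_combination f * h' - f' * h
  have hP : P ≠ 0 := by rintro rfl; simp at hl
  have hdvd : P ∣ f * g' - f' * g := by
    refine ⟨x * (f * g' - f' * g) + y * (q * g' - q' * g) + z * (f * q' - f' * q), ?_⟩
    linear_combination -(f * g' - f' * g) * hxyz + y * e1 + z * e2
  have hdet : f * g' - f' * g = 0 := by
    refine eq_zero_of_dvd_of_degree_lt hdvd ((degree_lt_degree_iff_mem_degreeLT hP).mpr ?_)
    refine degreeLT_mono (Nat.succ_le_of_lt hl) ?_
    rw [mul_comm f', Nat.succ_eq_add_one, add_right_comm]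
    exact Submodule.sub_mem _ (mul_mem_degreeLT_add hf.1 hf'.2) (mul_mem_degreeLT_add hf.2 hf'.1)
  rw [hdet, zero_mul] at e1 e2
  have e1' := (mul_eq_zero.mp e1.symm).resolve_left hP
  have e2' := (mul_eq_zero.mp e2.symm).resolve_left hP
  by_cases hf0 : f = 0
  · have hg0 : g ≠ 0 := by simpa [hf0] using h0
    have hf0' : f' = 0 := by simpa [hf0, hg0] using hdet
    have hg0' : g' ≠ 0 := by simpa [hf0'] using h0'
    refine (hrp.eq_of_smul_eq hrp' hg0' hg0 ?_).2
    simp only [Prod.smul_mk, smul_eq_mul, Prod.mk.injEq]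
    refine ⟨?_, mul_comm _ _, ?_⟩
    · rw [hf0, hf0', mul_zero, mul_zero]
    · linear_combination e1'
  · have hf0' : f' ≠ 0 := by
      rintro rfl
      have : g' = 0 := by simpa [hf0] using hdet
      simp [this] at h0'
    refine (hrp.eq_of_smul_eq hrp' hf0' hf0 ?_).2
    simp only [Prod.smul_mk, smul_eq_mul, Prod.mk.injEq]
    refine ⟨mul_comm _ _, ?_, ?_⟩
    · linear_combination -hdet
    · linear_combination -e2'

/-- Primitive residue triples of level `k` with a primitive relation of level `n`. -/
def relatedTriples (k n : ℕ) : Set PolyTriple :=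
  {t ∈ residueTriples | t.1.natDegree = k ∧ IsPrimitiveTriple t ∧
    ∃ r ∈ relationTriples, relationLevel r = n ∧ IsPrimitiveTriple r ∧ IsRelation r t}

theorem ncard_relatedTriples {k n : ℕ} (hn : n ≤ k) (hn' : 2 * n ≤ k) :
    (relatedTriples (k + 1) n).ncard * 2 ^ n =
      {r ∈ relationTriples | relationLevel r = n ∧ IsPrimitiveTriple r}.ncard * (2 * 4 ^ k) := by
  classical
  have hfin : {r ∈ relationTriples | relationLevel r = n ∧ IsPrimitiveTriple r}.Finite :=
    (finite_relationTriples_level n).subset fun r hr => ⟨hr.1, hr.2.1⟩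
  have hfin' : ∀ r, {t ∈ residueTriples | t.1.natDegree = k + 1 ∧ IsPrimitiveTriple t ∧
      IsRelation r t}.Finite := fun r =>
    (finite_residueTriples_level (k + 1)).subset fun r hr => ⟨hr.1, hr.2.1⟩
  have heq : relatedTriples (k + 1) n =
      (hfin.toFinset.biUnion fun r => (hfin' r).toFinset : Finset PolyTriple) := by
    ext t
    simp only [relatedTriples, Finset.coe_biUnion, Set.Finite.coe_toFinset, Set.mem_iUnion,
      Set.mem_ofPred_eq, exists_prop]
    tauto
  rw [heq, Set.ncard_coe_finset, Finset.card_biUnion, Finset.sum_mul, Finset.sum_congr rfl,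
    Finset.sum_const, smul_eq_mul, Set.ncard_eq_toFinset_card _ hfin]
  · intro r hr
    rw [Set.Finite.mem_toFinset] at hr
    rw [← Set.ncard_eq_toFinset_card _ (hfin' r), ← hr.2.1]
    exact ncard_primitive_isRelation hr.1 hr.2.2 (by have := hr.2.1; omega)
  · intro r hr r' hr' hne
    rw [Finset.mem_coe, Set.Finite.mem_toFinset] at hr hr'
    rw [Function.onFun, Finset.disjoint_left]
    intro t ht ht'
    rw [Set.Finite.mem_toFinset] at ht ht'
    obtain ⟨-, h1, h2, h3⟩ := ht
    obtain ⟨-, h1', h2', h3'⟩ := ht'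
    exact hne (h3.eq h2 hr.1 hr'.1 hr.2.2 hr'.2.2 h3' (by rw [hr.2.1, hr'.2.1, h1]; omega))

theorem ncard_hasSmallRelation {k e : ℕ} (he : 2 * (e + 1) ≤ k + 1) :
    {t ∈ residueTriples | t.1.natDegree = k + 1 ∧ IsPrimitiveTriple t ∧
      HasSmallRelation (e + 1) t}.ncard = 6 * 4 ^ k * 4 ^ e := by
  have hiff : ∀ e, {t ∈ residueTriples | t.1.natDegree = k + 1 ∧ IsPrimitiveTriple t ∧
      HasSmallRelation (e + 1) t} = {t ∈ residueTriples | t.1.natDegree = k + 1 ∧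
      IsPrimitiveTriple t ∧ HasSmallRelation e t} ∪ relatedTriples (k + 1) e := by
    intro e
    ext t
    simp only [relatedTriples, Set.mem_union, Set.mem_ofPred_eq]
    by_cases ht : t ∈ residueTriples
    · rw [hasSmallRelation_iff ht, hasSmallRelation_iff ht]
      simp only [Nat.lt_succ_iff_lt_or_eq, or_and_right, and_or_left, exists_or]
    · simp [ht]
  have hfin : ∀ e, {t ∈ residueTriples | t.1.natDegree = k + 1 ∧ IsPrimitiveTriple t ∧
      HasSmallRelation e t}.Finite := fun e =>
    (finite_residueTriples_level (k + 1)).subset fun r hr => ⟨hr.1, hr.2.1⟩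
  have hfin' : ∀ e, (relatedTriples (k + 1) e).Finite := fun e =>
    (finite_residueTriples_level (k + 1)).subset fun r hr => ⟨hr.1, hr.2.1⟩
  have hdisj : ∀ e, 2 * (e + 1) ≤ k + 1 →
      Disjoint {t ∈ residueTriples | t.1.natDegree = k + 1 ∧ IsPrimitiveTriple t ∧
        HasSmallRelation e t} (relatedTriples (k + 1) e) := by
    intro e he
    rw [Set.disjoint_left]
    rintro t ⟨ht, hd, hp, h⟩ ⟨-, -, -, r, hr, hrl, hrp, hrt⟩
    obtain ⟨r', hr', hrl', hrp', hrt'⟩ := (hasSmallRelation_iff ht).mp h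
    have := hrt.eq hp hr hr' hrp hrp' hrt' (by omega)
    subst this
    omega
  induction e with
  | zero =>
    have h := ncard_relatedTriples (k := k) (n := 0) (by omega) (by omega)
    have h0 : {t ∈ residueTriples | t.1.natDegree = k + 1 ∧ IsPrimitiveTriple t ∧
        HasSmallRelation 0 t} = ∅ := by
      refine Set.eq_empty_of_forall_notMem ?_
      rintro t ⟨ht, -, -, h⟩
      obtain ⟨r, -, hr, -⟩ := (hasSmallRelation_iff ht).mp h
      omega
    rw [hiff, h0, Set.empty_union]
    rw [ncard_primitive_relationTriples_level_zero] at h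
    rw [pow_zero, mul_one] at *
    rw [h]
    ring
  | succ e ih =>
    have h := ncard_relatedTriples (k := k) (n := e + 1) (by omega) (by omega)
    rw [hiff, Set.ncard_union_eq (hdisj _ he) (hfin _) (hfin' _), ih (by omega)]
    rw [ncard_primitive_relationTriples_level_succ] at h
    have : (relatedTriples (k + 1) (e + 1)).ncard = 18 * 4 ^ e * 4 ^ k := by
      have h8 : (8 : ℕ) ^ e = 2 ^ e * 4 ^ e := by
        rw [← mul_pow]; norm_num
      refine Nat.eq_of_mul_eq_mul_right (pow_pos (n := e + 1) two_pos) (h.trans ?_)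
      rw [h8]
      ring
    rw [this]
    ring

theorem convex_growth {d : ℕ → ℕ} (hd : ∀ j, 2 * d (j + 1) ≤ d (j + 2) + d j) {a c n : ℕ}
    (h : d a + c * n < d (a + n)) (m : ℕ) : d (a + n) + (c + 1) * m ≤ d (a + n + m) := by
  have hstep : ∀ n, d a + c * n < d (a + n) → d (a + n) + c + 1 ≤ d (a + n + 1) := by
    intro n
    induction n with
    | zero => simp
    | succ n ih =>
      intro h
      have hc := hd (a + n)
      by_cases hn : d a + c * n < d (a + n)
      · have := ih hn
        grind
      · grind
  have hgrow : ∀ m, d (a + n + m) + c + 1 ≤ d (a + n + m + 1) := by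
    intro m
    induction m with
    | zero => exact hstep n h
    | succ m ih =>
      have := hd (a + n + m)
      grind
  induction m with
  | zero => simp
  | succ m ih =>
    have := hgrow m
    grind

/-- The relation module of the residue triple `(P, u, v)`: pairs with `P ∣ f u + g v`. -/
noncomputable def relationModule (t : PolyTriple) : Submodule (ZMod 2) ((ZMod 2)[X] × (ZMod 2)[X]) where
  carrier := {x | t.1 ∣ x.1 * t.2.1 + x.2 * t.2.2}
  zero_mem' := by simp
  add_mem' {x y} hx hy := by
    have := dvd_add hx hy
    rw [Set.mem_ofPred_eq]
    convert this using 1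
    simp only [Prod.fst_add, Prod.snd_add]
    ring
  smul_mem' c x hx := by
    rw [Set.mem_ofPred_eq, Prod.smul_fst, Prod.smul_snd, smul_mul_assoc, smul_mul_assoc, ← smul_add,
      smul_eq_C_mul]
    exact Dvd.dvd.mul_left hx _

theorem mem_relationModule {t : PolyTriple} {x : (ZMod 2)[X] × (ZMod 2)[X]} :
    x ∈ relationModule t ↔ t.1 ∣ x.1 * t.2.1 + x.2 * t.2.2 := Iff.rfl

/-- The relations whose coefficients have degree less than `j`. -/
noncomputable def boundedRelations (t : PolyTriple) (j : ℕ) :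
    Submodule (ZMod 2) ((ZMod 2)[X] × (ZMod 2)[X]) :=
  relationModule t ⊓ (degreeLT (ZMod 2) j).prod (degreeLT (ZMod 2) j)

theorem mem_boundedRelations {t : PolyTriple} {j : ℕ} {x : (ZMod 2)[X] × (ZMod 2)[X]} :
    x ∈ boundedRelations t j ↔ t.1 ∣ x.1 * t.2.1 + x.2 * t.2.2 ∧
      x.1 ∈ degreeLT (ZMod 2) j ∧ x.2 ∈ degreeLT (ZMod 2) j := Iff.rfl

instance finite_boundedRelations (t : PolyTriple) (j : ℕ) : Finite (boundedRelations t j) :=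
  Set.finite_coe_iff.mpr (((finite_coe_degreeLT_zmod_two j).prod
    (finite_coe_degreeLT_zmod_two j)).subset fun _ h => h.2)

/-- Multiplication of a pair of polynomials by `X`. -/
noncomputable def pairMulX :
    (ZMod 2)[X] × (ZMod 2)[X] →ₗ[ZMod 2] (ZMod 2)[X] × (ZMod 2)[X] :=
  (LinearMap.mulLeft (ZMod 2) X).prodMap (LinearMap.mulLeft (ZMod 2) X)

theorem pairMulX_injective : Function.Injective pairMulX :=
  Prod.map_injective.mpr ⟨mul_right_injective₀ X_ne_zero, mul_right_injective₀ X_ne_zero⟩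

theorem X_mul_mem_degreeLT_iff {p : (ZMod 2)[X]} {j : ℕ} :
    X * p ∈ degreeLT (ZMod 2) (j + 1) ↔ p ∈ degreeLT (ZMod 2) j := by
  rw [mem_degreeLT_iff_natDegree, mem_degreeLT_iff_natDegree]
  by_cases hp : p = 0
  · simp [hp]
  · rw [natDegree_X_mul hp]
    simp [hp]

theorem finrank_boundedRelations_convex (t : PolyTriple) (j : ℕ) :
    2 * Module.finrank (ZMod 2) (boundedRelations t (j + 1)) ≤
      Module.finrank (ZMod 2) (boundedRelations t (j + 2)) +
        Module.finrank (ZMod 2) (boundedRelations t j) := by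
  have hmap : ∀ i, Module.finrank (ZMod 2) ((boundedRelations t i).map pairMulX) =
      Module.finrank (ZMod 2) (boundedRelations t i) := fun i =>
    (LinearEquiv.finrank_eq (Submodule.equivMapOfInjective _ pairMulX_injective _)).symm
  have hsup : boundedRelations t (j + 1) ⊔ (boundedRelations t (j + 1)).map pairMulX ≤
      boundedRelations t (j + 2) := by
    refine sup_le (fun x hx => ⟨hx.1, degreeLT_mono (Nat.le_succ _) hx.2.1,
      degreeLT_mono (Nat.le_succ _) hx.2.2⟩) ?_
    rintro _ ⟨x, hx, rfl⟩
    refine ⟨?_, X_mul_mem_degreeLT_iff.mpr hx.2.1, X_mul_mem_degreeLT_iff.mpr hx.2.2⟩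
    have := (mem_boundedRelations.mp hx).1.mul_left X
    rw [SetLike.mem_coe, mem_relationModule]
    convert this using 1
    change X * x.1 * _ + X * x.2 * _ = _
    ring
  have hinf : boundedRelations t (j + 1) ⊓ (boundedRelations t (j + 1)).map pairMulX ≤
      (boundedRelations t j).map pairMulX := by
    rintro _ ⟨h, x, hx, rfl⟩
    exact ⟨x, ⟨hx.1, X_mul_mem_degreeLT_iff.mp h.2.1, X_mul_mem_degreeLT_iff.mp h.2.2⟩, rfl⟩
  have h1 := Submodule.finrank_sup_add_finrank_inf_eq (boundedRelations t (j + 1))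
    ((boundedRelations t (j + 1)).map pairMulX)
  have h2 := Submodule.finrank_mono hsup
  have h3 := Submodule.finrank_mono hinf
  rw [hmap] at h1 h3
  omega

/-- The map `(f, g) ↦ (f u + g v) mod P` on pairs of polynomials of degree less than `j`. -/
noncomputable def residueMap {t : PolyTriple} (ht : t.1 ≠ 0) (j : ℕ) :
    (degreeLT (ZMod 2) j × degreeLT (ZMod 2) j) →ₗ[ZMod 2] degreeLT (ZMod 2) t.1.natDegree :=
  LinearMap.codRestrict _ ((modByMonicHom t.1).comp
    (((LinearMap.mulRight (ZMod 2) t.2.1).comp (Submodule.subtype _)).coprod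
      ((LinearMap.mulRight (ZMod 2) t.2.2).comp (Submodule.subtype _))))
    fun _ => modByMonic_mem_degreeLT ht _

theorem coe_residueMap {t : PolyTriple} (ht : t.1 ≠ 0) {j : ℕ}
    (x : degreeLT (ZMod 2) j × degreeLT (ZMod 2) j) :
    (residueMap ht j x : (ZMod 2)[X]) =
      ((x.1 : (ZMod 2)[X]) * t.2.1 + (x.2 : (ZMod 2)[X]) * t.2.2) %ₘ t.1 := rfl

theorem finrank_degreeLT_zmod_two (n : ℕ) :
    Module.finrank (ZMod 2) (degreeLT (ZMod 2) n) = n := by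
  rw [LinearEquiv.finrank_eq (degreeLTEquiv (ZMod 2) n)]
  simp

theorem finrank_boundedRelations_add {t : PolyTriple} (ht : t.1 ≠ 0) (j : ℕ) :
    Module.finrank (ZMod 2) (boundedRelations t j) +
      Module.finrank (ZMod 2) (LinearMap.range (residueMap ht j)) = 2 * j := by
  have h := LinearMap.finrank_range_add_finrank_ker (residueMap ht j)
  rw [Module.finrank_prod, finrank_degreeLT_zmod_two] at h
  have hker : Module.finrank (ZMod 2) (boundedRelations t j) =
      Module.finrank (ZMod 2) (LinearMap.ker (residueMap ht j)) := by
    have hinj : Function.Injective ((degreeLT (ZMod 2) j).subtype.prodMap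
        (degreeLT (ZMod 2) j).subtype) :=
      Prod.map_injective.mpr ⟨Subtype.val_injective, Subtype.val_injective⟩
    have heq : boundedRelations t j = (LinearMap.ker (residueMap ht j)).map
        ((degreeLT (ZMod 2) j).subtype.prodMap (degreeLT (ZMod 2) j).subtype) := by
      ext x
      rw [mem_boundedRelations]
      constructor
      · rintro ⟨h, h1, h2⟩
        refine ⟨(⟨x.1, h1⟩, ⟨x.2, h2⟩), ?_, rfl⟩
        rw [SetLike.mem_coe, LinearMap.mem_ker, Subtype.ext_iff, coe_residueMap]
        exact (modByMonic_eq_zero_iff_dvd (monic_of_ne_zero_zmod_two ht)).mpr h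
      · rintro ⟨y, hy, rfl⟩
        rw [SetLike.mem_coe, LinearMap.mem_ker, Subtype.ext_iff, coe_residueMap] at hy
        exact ⟨(modByMonic_eq_zero_iff_dvd (monic_of_ne_zero_zmod_two ht)).mp hy, y.1.2, y.2.2⟩
    rw [heq]
    exact (LinearEquiv.finrank_eq (Submodule.equivMapOfInjective _ hinj _)).symm
  omega

theorem residueMap_surjective_iff {t : PolyTriple} (ht : t.1 ≠ 0) (j : ℕ) :
    Function.Surjective (residueMap ht j) ↔
      Module.finrank (ZMod 2) (boundedRelations t j) + t.1.natDegree = 2 * j := by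
  have h := finrank_boundedRelations_add ht j
  rw [← LinearMap.range_eq_top]
  constructor
  · intro h'
    rw [h', finrank_top, finrank_degreeLT_zmod_two] at h
    exact h
  · intro h'
    refine Submodule.eq_top_of_finrank_eq ?_
    rw [finrank_degreeLT_zmod_two]
    omega

theorem le_finrank_boundedRelations_add {t : PolyTriple} (ht : t.1 ≠ 0) (j : ℕ) :
    2 * j ≤ Module.finrank (ZMod 2) (boundedRelations t j) + t.1.natDegree := by
  have h := finrank_boundedRelations_add ht j
  have h' := Submodule.finrank_le (LinearMap.range (residueMap ht j))
  rw [finrank_degreeLT_zmod_two] at h'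
  omega

theorem IsPrimitiveTriple.residueMap_surjective {t : PolyTriple} (hp : IsPrimitiveTriple t)
    (ht : t.1 ≠ 0) {j : ℕ} (hj : t.1.natDegree ≤ j) : Function.Surjective (residueMap ht j) := by
  obtain ⟨x, y, z, h⟩ := hp
  rintro ⟨r, hr⟩
  refine ⟨(⟨(r * y) %ₘ t.1, degreeLT_mono hj (modByMonic_mem_degreeLT ht _)⟩,
    ⟨(r * z) %ₘ t.1, degreeLT_mono hj (modByMonic_mem_degreeLT ht _)⟩), Subtype.ext ?_⟩
  rw [coe_residueMap]
  refine (div_modByMonic_unique (f := (r * y) %ₘ t.1 * t.2.1 + (r * z) %ₘ t.1 * t.2.2)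
    (-(r * x) - ((r * y) /ₘ t.1) * t.2.1 - ((r * z) /ₘ t.1) * t.2.2) r
    (monic_of_ne_zero_zmod_two ht)
    ⟨?_, (degree_lt_degree_iff_mem_degreeLT ht).mpr hr⟩).2
  have e1 := modByMonic_add_div (r * y) t.1
  have e2 := modByMonic_add_div (r * z) t.1
  linear_combination (-r) * h - t.2.1 * e1 - t.2.2 * e2

theorem isPrimitiveTriple_of_residueMap_surjective {t : PolyTriple} (ht : t.1 ≠ 0) {j : ℕ}
    (h : Function.Surjective (residueMap ht j)) : IsPrimitiveTriple t := by
  obtain ⟨x, hx⟩ := h ⟨1 %ₘ t.1, modByMonic_mem_degreeLT ht _⟩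
  have hx' := congrArg Subtype.val hx
  rw [coe_residueMap] at hx'
  dsimp only at hx'
  have e1 := modByMonic_add_div ((x.1 : (ZMod 2)[X]) * t.2.1 + (x.2 : (ZMod 2)[X]) * t.2.2) t.1
  have e2 := modByMonic_add_div 1 t.1
  refine ⟨1 /ₘ t.1 - ((x.1 : (ZMod 2)[X]) * t.2.1 + (x.2 : (ZMod 2)[X]) * t.2.2) /ₘ t.1,
    x.1, x.2, ?_⟩
  linear_combination e2 - e1 + hx'

theorem hasSmallRelation_iff_finrank {t : PolyTriple} {e : ℕ} :
    HasSmallRelation e t ↔ Module.finrank (ZMod 2) (boundedRelations t e) ≠ 0 := by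
  rw [Ne, Submodule.finrank_eq_zero, Submodule.eq_bot_iff]
  push Not
  constructor
  · rintro ⟨f, hf, g, hg, h0, h⟩
    exact ⟨(f, g), ⟨h, hf, hg⟩, by simpa [Prod.ext_iff, imp_iff_not_or] using h0⟩
  · rintro ⟨⟨f, g⟩, ⟨h, hf, hg⟩, h0⟩
    exact ⟨f, hf, g, hg, by simpa [Prod.ext_iff, imp_iff_not_or] using h0, h⟩

theorem residueMap_surjective_iff_hasSmallRelation {t : PolyTriple} (ht : t.1 ≠ 0) {s : ℕ}
    (hs : t.1.natDegree ≤ 2 * s) : Function.Surjective (residueMap ht s) ↔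
      IsPrimitiveTriple t ∧ ¬ HasSmallRelation (t.1.natDegree - s) t := by
  rw [hasSmallRelation_iff_finrank, not_not]
  have hd := finrank_boundedRelations_convex t
  have hle := le_finrank_boundedRelations_add ht s
  have hiff := residueMap_surjective_iff ht s
  have h0 := finrank_boundedRelations_add ht 0
  set k := t.1.natDegree with hk
  set d : ℕ → ℕ := fun j => Module.finrank (ZMod 2) (boundedRelations t j) with hdef
  change d 0 + _ = _ at h0
  change _ ↔ d s + _ = _ at hiff
  change _ ≤ d s + _ at hle
  change _ ↔ _ ∧ d (k - s) = 0
  constructor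
  · intro h
    refine ⟨isPrimitiveTriple_of_residueMap_surjective ht h, ?_⟩
    by_contra hne
    have := convex_growth (d := d) hd (a := 0) (c := 0) (n := k - s)
      (by rw [zero_add]; omega) (s - (k - s))
    have hs' : 0 + (k - s) + (s - (k - s)) = s := by omega
    rw [hs', zero_add] at this
    have := hiff.mp h
    have hks : s ≤ k := by
      by_contra hlt
      have : k - s = 0 := by omega
      rw [this] at hne
      omega
    omega
  · rintro ⟨hp, h⟩
    by_cases hks : k ≤ s
    · exact hp.residueMap_surjective ht hks
    rw [hiff]
    by_contra hne
    have hk' : d k + k = 2 * k :=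
      (residueMap_surjective_iff ht k).mp (hp.residueMap_surjective ht le_rfl)
    have hs' : k - s + (s - (k - s)) = s := by omega
    have := convex_growth (d := d) hd (a := k - s) (c := 1) (n := s - (k - s))
      (by rw [hs']; omega) (k - s)
    rw [hs'] at this
    have hs'' : s + (k - s) = k := by omega
    rw [hs''] at this
    omega

/-- The functional sending `r` to the coefficient of `X ^ (deg P - 1)` in `r mod P`. -/
noncomputable def residueFunctional (P : (ZMod 2)[X]) : (ZMod 2)[X] →ₗ[ZMod 2] ZMod 2 :=
  (lcoeff (ZMod 2) (P.natDegree - 1)).comp (modByMonicHom P)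

theorem residueFunctional_apply (P r : (ZMod 2)[X]) :
    residueFunctional P r = (r %ₘ P).coeff (P.natDegree - 1) := rfl

theorem residueFunctional_of_dvd {P r : (ZMod 2)[X]} (hP : P ≠ 0) (h : P ∣ r) :
    residueFunctional P r = 0 := by
  rw [residueFunctional_apply, (modByMonic_eq_zero_iff_dvd (monic_of_ne_zero_zmod_two hP)).mpr h,
    coeff_zero]

theorem residueFunctional_congr {P r r' : (ZMod 2)[X]} (hP : P ≠ 0) (h : P ∣ r - r') :
    residueFunctional P r = residueFunctional P r' := by
  rw [← sub_eq_zero, ← map_sub, residueFunctional_of_dvd hP h]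

theorem residueFunctional_of_mem {P r : (ZMod 2)[X]} (hP : P ≠ 0)
    (h : r ∈ degreeLT (ZMod 2) P.natDegree) :
    residueFunctional P r = r.coeff (P.natDegree - 1) := by
  rw [residueFunctional_apply, (modByMonic_eq_self_iff (monic_of_ne_zero_zmod_two hP)).mpr
    ((degree_lt_degree_iff_mem_degreeLT hP).mpr h)]

theorem dvd_of_residueFunctional_eq_zero {P r : (ZMod 2)[X]} (hP : P ≠ 0)
    (h : ∀ i < P.natDegree, residueFunctional P (X ^ i * r) = 0) : P ∣ r := by
  rw [← modByMonic_eq_zero_iff_dvd (monic_of_ne_zero_zmod_two hP)]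
  by_contra h0
  have hmem := (mem_degreeLT_iff_natDegree.mp (modByMonic_mem_degreeLT hP r)).resolve_left h0
  have hi := h (P.natDegree - 1 - (r %ₘ P).natDegree) (by omega)
  rw [residueFunctional_congr (r' := X ^ (P.natDegree - 1 - (r %ₘ P).natDegree) * (r %ₘ P)) hP,
    residueFunctional_of_mem hP, coeff_X_pow_mul', if_pos (by omega)] at hi
  · have : P.natDegree - 1 - (P.natDegree - 1 - (r %ₘ P).natDegree) = (r %ₘ P).natDegree := by
      omega
    rw [this] at hi
    exact leadingCoeff_ne_zero.mpr h0 hi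
  · rw [mem_degreeLT_iff_natDegree, natDegree_mul (pow_ne_zero _ X_ne_zero) h0, natDegree_X_pow]
    omega
  · rw [← mul_sub]
    refine Dvd.dvd.mul_left ⟨r /ₘ P, ?_⟩ _
    linear_combination -modByMonic_add_div r P

/-- No nonzero `Q` of degree less than `deg P` is orthogonal to the first `s` shifts of
`u` and `v`. -/
def IsFullResidue (s : ℕ) (t : PolyTriple) : Prop :=
  ∀ Q ∈ degreeLT (ZMod 2) t.1.natDegree,
    (∀ i < s, residueFunctional t.1 (X ^ i * (Q * t.2.1)) = 0) →
    (∀ i < s, residueFunctional t.1 (X ^ i * (Q * t.2.2)) = 0) → Q = 0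

theorem functional_eq_of_mem_degreeLT {φ ψ : (ZMod 2)[X] →ₗ[ZMod 2] ZMod 2} {N : ℕ}
    (h : ∀ n < N, φ (X ^ n) = ψ (X ^ n)) {p : (ZMod 2)[X]} (hp : p ∈ degreeLT (ZMod 2) N) :
    φ p = ψ p := by
  rw [degreeLT_eq_span_X_pow] at hp
  refine LinearMap.eqOn_span ?_ hp
  intro x hx
  simp only [Finset.coe_image, Finset.coe_range, Set.mem_image, Set.mem_Iio] at hx
  obtain ⟨i, hi, rfl⟩ := hx
  exact h i hi

theorem residueFunctional_mul_eq_zero_of_mem {P w f : (ZMod 2)[X]} {s : ℕ}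
    (h : ∀ i < s, residueFunctional P (X ^ i * w) = 0) (hf : f ∈ degreeLT (ZMod 2) s) :
    residueFunctional P (f * w) = 0 :=
  functional_eq_of_mem_degreeLT
    (φ := (residueFunctional P).comp (LinearMap.mulRight (ZMod 2) w)) (ψ := 0) h hf

theorem X_pow_mem_degreeLT {i s : ℕ} (h : i < s) : (X ^ i : (ZMod 2)[X]) ∈ degreeLT (ZMod 2) s := by
  rw [mem_degreeLT_iff_natDegree, natDegree_X_pow]
  exact Or.inr h

/-- Every functional on the polynomials of degree less than `deg P` is represented by a
residue modulo `P`. -/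
theorem exists_residueFunctional_mul_eq {P : (ZMod 2)[X]} (hP : P ≠ 0)
    (φ : Module.Dual (ZMod 2) (degreeLT (ZMod 2) P.natDegree)) :
    ∃ q ∈ degreeLT (ZMod 2) P.natDegree, ∀ r : degreeLT (ZMod 2) P.natDegree,
      residueFunctional P (q * (r : (ZMod 2)[X])) = φ r := by
  let B : degreeLT (ZMod 2) P.natDegree →ₗ[ZMod 2]
      Module.Dual (ZMod 2) (degreeLT (ZMod 2) P.natDegree) :=
    ((LinearMap.mul (ZMod 2) (ZMod 2)[X]).compr₂ (residueFunctional P)).domRestrict₁₂ _ _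
  have hB : ∀ q r, B q r = residueFunctional P ((q : (ZMod 2)[X]) * (r : (ZMod 2)[X])) :=
    fun _ _ => rfl
  have hinj : Function.Injective B := by
    rw [← LinearMap.ker_eq_bot, LinearMap.ker_eq_bot']
    rintro ⟨q, hq⟩ h0
    have : P ∣ q := dvd_of_residueFunctional_eq_zero hP fun i hi => by
      have := congrArg (fun ψ => ψ ⟨X ^ i, X_pow_mem_degreeLT hi⟩) h0
      rw [hB] at this
      rw [mul_comm]
      exact this
    exact Subtype.ext (eq_zero_of_dvd_of_degree_lt this
      ((degree_lt_degree_iff_mem_degreeLT hP).mpr hq))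
  obtain ⟨Q, hQ⟩ := (LinearMap.injective_iff_surjective_of_finrank_eq_finrank
    (Subspace.dual_finrank_eq).symm).mp hinj φ
  exact ⟨Q, Q.2, fun r => by rw [← hB, hQ]⟩

theorem isFullResidue_iff {s : ℕ} {t : PolyTriple} (ht : t.1 ≠ 0) :
    IsFullResidue s t ↔ Function.Surjective (residueMap ht s) := by
  have hres : ∀ (Q : (ZMod 2)[X]) (x : degreeLT (ZMod 2) s × degreeLT (ZMod 2) s),
      residueFunctional t.1 (Q * (residueMap ht s x : (ZMod 2)[X])) =
        residueFunctional t.1 ((x.1 : (ZMod 2)[X]) * (Q * t.2.1)) +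
          residueFunctional t.1 ((x.2 : (ZMod 2)[X]) * (Q * t.2.2)) := by
    intro Q x
    rw [← map_add, coe_residueMap]
    refine residueFunctional_congr ht ⟨-(Q * (((x.1 : (ZMod 2)[X]) * t.2.1 +
      (x.2 : (ZMod 2)[X]) * t.2.2) /ₘ t.1)), ?_⟩
    linear_combination Q * modByMonic_add_div ((x.1 : (ZMod 2)[X]) * t.2.1 +
      (x.2 : (ZMod 2)[X]) * t.2.2) t.1
  constructor
  · intro h
    rw [← LinearMap.range_eq_top]
    by_contra hne
    obtain ⟨φ, hφ, hle⟩ := Submodule.exists_le_ker_of_lt_top _ (lt_top_iff_ne_top.mpr hne)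
    obtain ⟨Q, hQm, hQ⟩ := exists_residueFunctional_mul_eq ht φ
    have hzero : ∀ x, residueFunctional t.1 ((Q : (ZMod 2)[X]) *
        (residueMap ht s x : (ZMod 2)[X])) = 0 := fun x => by
      rw [hQ]
      exact hle (LinearMap.mem_range_self _ x)
    have hQ0 : Q = 0 := h Q hQm
      (fun i hi => by simpa [hres] using hzero (⟨X ^ i, X_pow_mem_degreeLT hi⟩, 0))
      (fun i hi => by simpa [hres] using hzero (0, ⟨X ^ i, X_pow_mem_degreeLT hi⟩))
    refine hφ (LinearMap.ext fun r => ?_)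
    rw [← hQ, hQ0, zero_mul, map_zero, LinearMap.zero_apply]
  · intro h Q hQ hu hv
    refine eq_zero_of_dvd_of_degree_lt (p := t.1) (dvd_of_residueFunctional_eq_zero ht
      fun i hi => ?_) ((degree_lt_degree_iff_mem_degreeLT ht).mpr hQ)
    obtain ⟨x, hx⟩ := h ⟨X ^ i, X_pow_mem_degreeLT hi⟩
    have := hres Q x
    rw [hx, residueFunctional_mul_eq_zero_of_mem hu x.1.2,
      residueFunctional_mul_eq_zero_of_mem hv x.2.2, add_zero, mul_comm] at this
    exact this

theorem ncard_isFullResidue {s k : ℕ} (hk : k < s) :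
    {t ∈ residueTriples | t.1.natDegree = k + 1 ∧ IsFullResidue s t}.ncard = 6 * 8 ^ k := by
  rw [← ncard_primitive_residueTriples_level]
  congr 1
  ext t
  refine and_congr_right fun ht => and_congr_right fun hd => ?_
  have ht0 := ne_zero_of_mem_residueTriples ht
  rw [isFullResidue_iff ht0, residueMap_surjective_iff_hasSmallRelation ht0 (by omega),
    and_iff_left_iff_imp, hd, Nat.sub_eq_zero_of_le (by omega), hasSmallRelation_iff ht]
  rintro - ⟨r, -, hr, -⟩
  omega

theorem ncard_isFullResidue_add {s e : ℕ} (he : e < s) :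
    {t ∈ residueTriples | t.1.natDegree = s + e + 1 ∧ IsFullResidue s t}.ncard +
      6 * 4 ^ (s + e) * 4 ^ e = 6 * 8 ^ (s + e) := by
  rw [← ncard_primitive_residueTriples_level, ← ncard_hasSmallRelation (by omega),
    ← Set.ncard_union_eq _ ((finite_residueTriples_level (s + e + 1)).subset fun _ h => ⟨h.1, h.2.1⟩)
      ((finite_residueTriples_level (s + e + 1)).subset fun _ h => ⟨h.1, h.2.1⟩)]
  · congr 1
    ext t
    simp only [Set.mem_union, Set.mem_ofPred_eq]
    by_cases ht : t ∈ residueTriples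
    · have ht0 := ne_zero_of_mem_residueTriples ht
      by_cases hd : t.1.natDegree = s + e + 1
      · rw [isFullResidue_iff ht0, residueMap_surjective_iff_hasSmallRelation ht0 (by omega), hd,
          show s + e + 1 - s = e + 1 by omega]
        tauto
      · simp [hd]
    · simp [ht]
  · rw [Set.disjoint_left]
    rintro t ⟨ht, hd, h⟩ ⟨-, -, -, h'⟩
    have ht0 := ne_zero_of_mem_residueTriples ht
    rw [isFullResidue_iff ht0, residueMap_surjective_iff_hasSmallRelation ht0 (by omega), hd,
      show s + e + 1 - s = e + 1 by omega] at h
    exact h.2 h'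

/-- The functional on polynomials whose value at `X ^ n` is the `n`-th term of the finite
sequence `a`. -/
noncomputable def sequenceFunctional {N : ℕ} (a : Fin N → ZMod 2) : (ZMod 2)[X] →ₗ[ZMod 2] ZMod 2 :=
  ∑ n, a n • lcoeff (ZMod 2) n

theorem sequenceFunctional_X_pow {N : ℕ} (a : Fin N → ZMod 2) {n : ℕ} (h : n < N) :
    sequenceFunctional a (X ^ n) = a ⟨n, h⟩ := by
  simp only [sequenceFunctional, LinearMap.sum_apply, LinearMap.smul_apply, lcoeff_apply,
    coeff_X_pow, smul_eq_mul, mul_ite, mul_one, mul_zero]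
  rw [Finset.sum_eq_single ⟨n, h⟩]
  · simp
  · intro b _ hb
    rw [if_neg fun h' => hb (Fin.ext h')]
  · simp

/-- The `2 s × k` matrix stacking the Hankel matrices of two functionals has trivial kernel. -/
def IsWindowFull (s k : ℕ) (φ ψ : (ZMod 2)[X] →ₗ[ZMod 2] ZMod 2) : Prop :=
  ∀ Q ∈ degreeLT (ZMod 2) k, (∀ i < s, φ (X ^ i * Q) = 0) → (∀ i < s, ψ (X ^ i * Q) = 0) → Q = 0

theorem X_pow_mul_mem_degreeLT {Q : (ZMod 2)[X]} {i s k : ℕ} (hi : i < s)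
    (hQ : Q ∈ degreeLT (ZMod 2) (k + 1)) : X ^ i * Q ∈ degreeLT (ZMod 2) (s + k) :=
  mul_mem_degreeLT_add (X_pow_mem_degreeLT hi) hQ

theorem IsWindowFull.congr {s k N : ℕ} {φ ψ φ' ψ' : (ZMod 2)[X] →ₗ[ZMod 2] ZMod 2}
    (h : IsWindowFull s k φ ψ) (hN : s + k ≤ N + 1) (hφ : ∀ n < N, φ (X ^ n) = φ' (X ^ n))
    (hψ : ∀ n < N, ψ (X ^ n) = ψ' (X ^ n)) : IsWindowFull s k φ' ψ' := by
  cases k with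
  | zero =>
    intro Q hQ _ _
    simpa [mem_degreeLT_iff_natDegree] using hQ
  | succ k =>
    intro Q hQ h1 h2
    have hle : s + k ≤ N := by omega
    refine h Q hQ (fun i hi => ?_) fun i hi => ?_
    · rw [functional_eq_of_mem_degreeLT hφ (degreeLT_mono hle (X_pow_mul_mem_degreeLT hi hQ))]
      exact h1 i hi
    · rw [functional_eq_of_mem_degreeLT hψ (degreeLT_mono hle (X_pow_mul_mem_degreeLT hi hQ))]
      exact h2 i hi

/-- Pairs of sequences of length `N` whose stacked `2 s × k` Hankel matrix has trivial kernel. -/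
def fullPairs (s N k : ℕ) : Set ((Fin N → ZMod 2) × (Fin N → ZMod 2)) :=
  {p | IsWindowFull s k (sequenceFunctional p.1) (sequenceFunctional p.2)}

theorem ncard_fullPairs_succ_length {s N k : ℕ} (h : s + k ≤ N + 1) :
    (fullPairs s (N + 1) k).ncard = 4 * (fullPairs s N k).ncard := by
  let e : ((Fin N → ZMod 2) × (Fin N → ZMod 2)) × (ZMod 2 × ZMod 2) ≃
      (Fin (N + 1) → ZMod 2) × (Fin (N + 1) → ZMod 2) :=
    { toFun := fun x => (Fin.snoc x.1.1 x.2.1, Fin.snoc x.1.2 x.2.2)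
      invFun := fun y => ((Fin.init y.1, Fin.init y.2), (y.1 (Fin.last N), y.2 (Fin.last N)))
      left_inv := fun x => by simp
      right_inv := fun y => by simp }
  have hinit : ∀ (a : Fin (N + 1) → ZMod 2), ∀ n < N,
      sequenceFunctional a (X ^ n) = sequenceFunctional (Fin.init a) (X ^ n) := by
    intro a n hn
    rw [sequenceFunctional_X_pow _ hn, sequenceFunctional_X_pow _ (by omega)]
    rfl
  have heq : fullPairs s (N + 1) k = e '' (fullPairs s N k ×ˢ Set.univ) := by
    rw [Equiv.image_eq_preimage_symm]
    ext y
    simp only [Set.mem_preimage, Set.mem_prod, Set.mem_univ, and_true]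
    exact ⟨fun hy => hy.congr h (hinit _) (hinit _),
      fun hy => hy.congr h (fun n hn => (hinit _ n hn).symm) fun n hn => (hinit _ n hn).symm⟩
  rw [heq, Set.ncard_image_of_injective _ e.injective, Set.ncard_prod, Set.ncard_univ,
    Nat.card_prod, Nat.card_zmod, mul_comm]

theorem fullPairs_zero (s N : ℕ) : fullPairs s N 0 = Set.univ := by
  refine Set.eq_univ_of_forall fun p Q hQ _ _ => ?_
  simpa [mem_degreeLT_iff_natDegree] using hQ

/-- The functional `r ↦ residueFunctional P (r u)`. -/
noncomputable def multipleFunctional (P u : (ZMod 2)[X]) : (ZMod 2)[X] →ₗ[ZMod 2] ZMod 2 :=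
  (residueFunctional P).comp (LinearMap.mulRight (ZMod 2) u)

theorem multipleFunctional_apply (P u r : (ZMod 2)[X]) :
    multipleFunctional P u r = residueFunctional P (r * u) := rfl

theorem multipleFunctional_mul_self {P : (ZMod 2)[X]} (hP : P ≠ 0) (u r : (ZMod 2)[X]) :
    multipleFunctional P u (r * P) = 0 :=
  residueFunctional_of_dvd hP ((dvd_mul_left P r).mul_right u)

theorem isFullResidue_iff_isWindowFull {s : ℕ} {t : PolyTriple} : IsFullResidue s t ↔
    IsWindowFull s t.1.natDegree (multipleFunctional t.1 t.2.1) (multipleFunctional t.1 t.2.2) := by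
  simp only [IsFullResidue, IsWindowFull, multipleFunctional_apply, mul_assoc]

theorem sub_mem_degreeLT_of_monic {P P' : (ZMod 2)[X]} (hP : P ≠ 0) (hP' : P' ≠ 0)
    (h : P.natDegree = P'.natDegree) : P - P' ∈ degreeLT (ZMod 2) P.natDegree := by
  rw [mem_degreeLT, ← degree_eq_natDegree hP]
  exact degree_sub_lt_left (by rw [degree_eq_natDegree hP, degree_eq_natDegree hP', h]) hP
    (by rw [monic_of_ne_zero_zmod_two hP, monic_of_ne_zero_zmod_two hP'])

theorem functional_eq_of_vanish_shifts {φ ψ : (ZMod 2)[X] →ₗ[ZMod 2] ZMod 2} {P : (ZMod 2)[X]}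
    (hP : P ≠ 0) {s : ℕ} (h : ∀ r ∈ degreeLT (ZMod 2) P.natDegree, φ r = ψ r)
    (hφ : ∀ i < s, φ (X ^ i * P) = 0) (hψ : ∀ i < s, ψ (X ^ i * P) = 0) :
    ∀ n < s + P.natDegree, φ (X ^ n) = ψ (X ^ n) := by
  intro n hn
  induction n using Nat.strong_induction_on with
  | _ n ih =>
  by_cases hk : n < P.natDegree
  · exact h _ (X_pow_mem_degreeLT hk)
  · obtain ⟨i, rfl⟩ := Nat.exists_eq_add_of_le' (not_lt.mp hk)
    have hlow : P - X ^ P.natDegree ∈ degreeLT (ZMod 2) P.natDegree :=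
      sub_mem_degreeLT_of_monic hP (pow_ne_zero _ X_ne_zero) (natDegree_X_pow _).symm
    have hdec : X ^ (i + P.natDegree) = X ^ i * P - X ^ i * (P - X ^ P.natDegree) := by
      rw [pow_add]; ring
    rw [hdec, map_sub, map_sub, hφ i (by omega), hψ i (by omega)]
    congr 1
    refine functional_eq_of_mem_degreeLT (N := i + P.natDegree)
      (fun m hm => ih m hm (by omega)) ?_
    rw [mul_comm, add_comm]
    exact mul_mem_degreeLT_add hlow (X_pow_mem_degreeLT (Nat.lt_succ_self i))

theorem exists_multipleFunctional_eq {φ : (ZMod 2)[X] →ₗ[ZMod 2] ZMod 2} {P : (ZMod 2)[X]}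
    (hP : P ≠ 0) {s : ℕ} (hφ : ∀ i < s, φ (X ^ i * P) = 0) :
    ∃ u ∈ degreeLT (ZMod 2) P.natDegree,
      ∀ n < s + P.natDegree, φ (X ^ n) = multipleFunctional P u (X ^ n) := by
  obtain ⟨u, hu, h⟩ := exists_residueFunctional_mul_eq hP (φ.comp (Submodule.subtype _))
  refine ⟨u, hu, functional_eq_of_vanish_shifts hP (fun r hr => ?_) hφ fun i _ =>
    multipleFunctional_mul_self hP u _⟩
  rw [multipleFunctional_apply, mul_comm, h ⟨r, hr⟩]
  rfl

theorem eq_of_multipleFunctional_eq {P u u' : (ZMod 2)[X]} (hP : P ≠ 0)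
    (hu : u ∈ degreeLT (ZMod 2) P.natDegree) (hu' : u' ∈ degreeLT (ZMod 2) P.natDegree)
    (h : ∀ n < P.natDegree, multipleFunctional P u (X ^ n) = multipleFunctional P u' (X ^ n)) :
    u = u' := by
  rw [← sub_eq_zero]
  refine eq_zero_of_dvd_of_degree_lt (p := P) (dvd_of_residueFunctional_eq_zero hP fun i hi => ?_)
    ((degree_lt_degree_iff_mem_degreeLT hP).mpr (Submodule.sub_mem _ hu hu'))
  rw [mul_sub, map_sub, sub_eq_zero]
  exact h i hi

theorem ncard_fullPairs_succ_width (s k : ℕ) :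
    (fullPairs s (s + k) (k + 1)).ncard +
      {t ∈ residueTriples | t.1.natDegree = k ∧ IsFullResidue s t}.ncard =
        (fullPairs s (s + k) k).ncard := by
  have hsub : fullPairs s (s + k) (k + 1) ⊆ fullPairs s (s + k) k :=
    fun p hp Q hQ => hp Q (degreeLT_mono k.le_succ hQ)
  have key : {t ∈ residueTriples | t.1.natDegree = k ∧ IsFullResidue s t}.ncard =
      (fullPairs s (s + k) k \ fullPairs s (s + k) (k + 1)).ncard := by
    have hval : ∀ P u : (ZMod 2)[X], ∀ n < s + k, multipleFunctional P u (X ^ n) =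
        sequenceFunctional (fun n : Fin (s + k) => multipleFunctional P u (X ^ (n : ℕ))) (X ^ n) :=
      fun P u n hn => (sequenceFunctional_X_pow
        (fun n : Fin (s + k) => multipleFunctional P u (X ^ (n : ℕ))) hn).symm
    refine Set.ncard_congr (fun t _ => (fun n => multipleFunctional t.1 t.2.1 (X ^ (n : ℕ)),
      fun n => multipleFunctional t.1 t.2.2 (X ^ (n : ℕ)))) ?_ ?_ ?_
    · rintro ⟨P, u, v⟩ ⟨ht, rfl, h⟩
      have hP : P ≠ 0 := ne_zero_of_mem_residueTriples ht
      refine ⟨(isFullResidue_iff_isWindowFull.mp h).congr (Nat.le_succ _) (hval _ _) (hval _ _),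
        fun h' => hP ?_⟩
      have hPm : P ∈ degreeLT (ZMod 2) (P.natDegree + 1) :=
        mem_degreeLT_iff_natDegree.mpr (Or.inr (Nat.lt_succ_self _))
      refine h' P hPm (fun i hi => ?_) fun i hi => ?_
      · rw [← functional_eq_of_mem_degreeLT (hval _ _) (X_pow_mul_mem_degreeLT hi hPm)]
        exact multipleFunctional_mul_self hP _ _
      · rw [← functional_eq_of_mem_degreeLT (hval _ _) (X_pow_mul_mem_degreeLT hi hPm)]
        exact multipleFunctional_mul_self hP _ _
    · rintro ⟨P, u, v⟩ ⟨P', u', v'⟩ ⟨ht, hd, h⟩ ⟨ht', hd', -⟩ he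
      have hP : P ≠ 0 := ne_zero_of_mem_residueTriples ht
      have hP' : P' ≠ 0 := ne_zero_of_mem_residueTriples ht'
      obtain ⟨-, hu, hv⟩ := residueTriples_level_iff.mp ⟨ht, rfl⟩
      obtain ⟨-, hu', hv'⟩ := residueTriples_level_iff.mp ⟨ht', rfl⟩
      dsimp only at *
      obtain ⟨he1, he2⟩ := Prod.mk.inj he
      have hu1 : ∀ n < s + k, multipleFunctional P u (X ^ n) = multipleFunctional P' u' (X ^ n) :=
        fun n hn => congrFun he1 ⟨n, hn⟩
      have hv1 : ∀ n < s + k, multipleFunctional P v (X ^ n) = multipleFunctional P' v' (X ^ n) :=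
        fun n hn => congrFun he2 ⟨n, hn⟩
      have hPm' : P' ∈ degreeLT (ZMod 2) (k + 1) :=
        mem_degreeLT_iff_natDegree.mpr (Or.inr (by omega))
      have hPP : P = P' := by
        rw [← sub_eq_zero]
        refine isFullResidue_iff_isWindowFull.mp h _
          (sub_mem_degreeLT_of_monic hP hP' (hd.trans hd'.symm)) (fun i hi => ?_) fun i hi => ?_
        · rw [mul_sub, map_sub, multipleFunctional_mul_self hP,
            functional_eq_of_mem_degreeLT hu1 (X_pow_mul_mem_degreeLT hi hPm'),
            multipleFunctional_mul_self hP', sub_zero]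
        · rw [mul_sub, map_sub, multipleFunctional_mul_self hP,
            functional_eq_of_mem_degreeLT hv1 (X_pow_mul_mem_degreeLT hi hPm'),
            multipleFunctional_mul_self hP', sub_zero]
      subst hPP
      rw [eq_of_multipleFunctional_eq hP hu hu' fun n hn => hu1 n (by omega),
        eq_of_multipleFunctional_eq hP hv hv' fun n hn => hv1 n (by omega)]
    · rintro ⟨a, b⟩ ⟨hfull, hnot⟩
      simp only [fullPairs, Set.mem_ofPred_eq, IsWindowFull, not_forall] at hnot
      obtain ⟨P, hPm, h1, h2, hP⟩ := hnot
      have hd : P.natDegree = k := by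
        refine (mem_degreeLT_succ_diff.mp ⟨hPm, fun hlt => hP ?_⟩).2
        exact hfull P hlt h1 h2
      subst hd
      obtain ⟨u, hu, hau⟩ := exists_multipleFunctional_eq hP h1
      obtain ⟨v, hv, hbv⟩ := exists_multipleFunctional_eq hP h2
      have ht : (P, u, v) ∈ residueTriples :=
        (residueTriples_level_iff (t := (P, u, v)).mpr ⟨⟨hP, rfl⟩, hu, hv⟩).1
      have hw : IsFullResidue s (P, u, v) :=
        isFullResidue_iff_isWindowFull.mpr (IsWindowFull.congr hfull (Nat.le_succ _) hau hbv)
      refine ⟨(P, u, v), ⟨ht, rfl, hw⟩, ?_⟩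
      refine Prod.ext (funext fun n => ?_) (funext fun n => ?_)
      · exact (hau n n.2).symm.trans (sequenceFunctional_X_pow a n.2)
      · exact (hbv n n.2).symm.trans (sequenceFunctional_X_pow b n.2)
  rw [key, Set.ncard_sdiff hsub, Nat.add_sub_cancel' (Set.ncard_le_ncard hsub)]

theorem functional_X_pow_mul_eq_sum (φ : (ZMod 2)[X] →ₗ[ZMod 2] ZMod 2) {k : ℕ} (c : Fin k → ZMod 2)
    (i : ℕ) : φ (X ^ i * ∑ j : Fin k, C (c j) * X ^ (j : ℕ)) = ∑ j : Fin k, φ (X ^ (i + j)) * c j := by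
  rw [Finset.mul_sum, map_sum]
  refine Finset.sum_congr rfl fun j _ => ?_
  rw [mul_left_comm, ← pow_add, ← smul_eq_C_mul, map_smul, smul_eq_mul, mul_comm]

theorem isWindowFull_iff {s k : ℕ} {φ ψ : (ZMod 2)[X] →ₗ[ZMod 2] ZMod 2} : IsWindowFull s k φ ψ ↔
    ∀ c : Fin k → ZMod 2, (∀ i < s, ∑ j : Fin k, φ (X ^ (i + j)) * c j = 0) →
      (∀ i < s, ∑ j : Fin k, ψ (X ^ (i + j)) * c j = 0) → c = 0 := by
  simp only [← functional_X_pow_mul_eq_sum]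
  constructor
  · intro h c h1 h2
    have h0 := h _ (Submodule.sum_mem _ fun j _ => ?_) h1 h2
    · funext j
      have := congrArg (fun p => coeff p j) h0
      simpa [finsetSum_coeff, coeff_X_pow, Fin.val_inj] using this
    · rw [← smul_eq_C_mul]
      exact Submodule.smul_mem _ _ (X_pow_mem_degreeLT j.2)
  · intro h Q hQ h1 h2
    have hsum : ∑ j : Fin k, C (Q.coeff j) * X ^ (j : ℕ) = Q :=
      (sum_fin (fun i a => C a * X ^ i) (by simp) (mem_degreeLT.mp hQ)).trans
        (sum_C_mul_X_pow_eq Q)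
    have h0 := h (fun j => Q.coeff j) (by rwa [hsum]) (by rwa [hsum])
    rw [← hsum]
    exact Finset.sum_eq_zero fun j _ => by rw [congrFun h0 j]; simp

theorem rank_eq_iff_mulVec_eq_zero {m : Type*} [Fintype m] {k : ℕ} (A : Matrix m (Fin k) (ZMod 2)) :
    A.rank = k ↔ ∀ c, A.mulVec c = 0 → c = 0 := by
  have h := LinearMap.finrank_range_add_finrank_ker A.mulVecLin
  rw [Module.finrank_fin_fun] at h
  have hker : (∀ c, A.mulVec c = 0 → c = 0) ↔ LinearMap.ker A.mulVecLin = ⊥ := by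
    rw [LinearMap.ker_eq_bot']
    rfl
  rw [hker, ← Submodule.finrank_eq_zero]
  change Module.finrank _ _ = k ↔ _
  omega

theorem rank_fromRows_hankel_iff {s k : ℕ} (a b : Fin (s + k) → ZMod 2) :
    (Matrix.fromRows (hankel s (k + 1) a) (hankel s (k + 1) b)).rank = k + 1 ↔
      (a, b) ∈ fullPairs s (s + k) (k + 1) := by
  have hrow : ∀ (a : Fin (s + k) → ZMod 2) (c : Fin (k + 1) → ZMod 2),
      (hankel s (k + 1) a).mulVec c = 0 ↔
        ∀ i < s, ∑ j : Fin (k + 1), sequenceFunctional a (X ^ (i + j)) * c j = 0 := by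
    intro a c
    rw [funext_iff, Fin.forall_iff]
    refine forall_congr' fun i => forall_congr' fun hi => ?_
    have hentry : (hankel s (k + 1) a).mulVec c ⟨i, hi⟩ =
        ∑ j : Fin (k + 1), sequenceFunctional a (X ^ (i + (j : ℕ))) * c j := by
      rw [Matrix.mulVec, dotProduct]
      refine Finset.sum_congr rfl fun j _ => ?_
      rw [sequenceFunctional_X_pow a (show i + (j : ℕ) < s + k by have := j.2; omega)]
      rfl
    rw [hentry]
    rfl
  rw [rank_eq_iff_mulVec_eq_zero, fullPairs, Set.mem_ofPred_eq, isWindowFull_iff]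
  refine forall_congr' fun c => ?_
  rw [Matrix.fromRows_mulVec, ← hrow, ← hrow, ← and_imp]
  refine imp_congr_left ?_
  simp [funext_iff]

theorem Gamma_succ_eq (s k : ℕ) :
    Gamma s s (k + 1) (k + 1) = (fullPairs s (s + k) (k + 1)).ncard :=
  Nat.card_congr (Equiv.subtypeEquivRight fun p => rank_fromRows_hankel_iff p.1 p.2)

theorem Gamma_one_add_one (s : ℕ) : Gamma s s 1 1 + 1 = 4 ^ s := by
  have h := ncard_fullPairs_succ_width s 0
  have hone : {t ∈ residueTriples | t.1.natDegree = 0 ∧ IsFullResidue s t}.ncard = 1 := by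
    rw [← pow_zero 8, ← ncard_residueTriples_level]
    congr 1
    ext t
    refine and_congr_right fun _ => and_iff_left_of_imp fun hd Q hQ _ _ => ?_
    simpa [hd, mem_degreeLT_iff_natDegree] using hQ
  rw [hone, fullPairs_zero, Set.ncard_univ, Nat.card_prod, Nat.card_fun, Nat.card_zmod,
    Nat.card_fin, ← mul_pow] at h
  rw [Gamma_succ_eq, h]
  norm_num

theorem Gamma_succ_succ_add (s k : ℕ) : Gamma s s (k + 2) (k + 2) +
    {t ∈ residueTriples | t.1.natDegree = k + 1 ∧ IsFullResidue s t}.ncard =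
      4 * Gamma s s (k + 1) (k + 1) := by
  rw [Gamma_succ_eq, Gamma_succ_eq, ← ncard_fullPairs_succ_length (by omega)]
  exact ncard_fullPairs_succ_width s (k + 1)

theorem two_mul_Gamma_of_le {s k : ℕ} (hk : k ≤ s) :
    2 * Gamma s s (k + 1) (k + 1) + 3 * 8 ^ k = 2 * 4 ^ s * 4 ^ k + 4 ^ k := by
  induction k with
  | zero =>
    have := Gamma_one_add_one s
    simp only [zero_add, pow_zero]
    omega
  | succ k ih =>
    have h := Gamma_succ_succ_add s k
    rw [ncard_isFullResidue hk] at h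
    have := ih (by omega)
    rw [pow_succ, pow_succ]
    grind

theorem two_mul_Gamma_of_ge {s e : ℕ} (he : e ≤ s) :
    2 * Gamma s s (s + e + 1) (s + e + 1) + 3 * 8 ^ (s + e) =
      2 * 4 ^ s * 4 ^ (s + e) + 4 ^ s * 16 ^ e := by
  induction e with
  | zero => simpa using two_mul_Gamma_of_le (le_refl s)
  | succ e ih =>
    have h := Gamma_succ_succ_add s (s + e)
    have h' := ncard_isFullResidue_add he
    have := ih (by omega)
    have h16 : (16 : ℤ) ^ e = 4 ^ e * 4 ^ e := by
      rw [← mul_pow]; norm_num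
    zify at h h' this ⊢
    rw [← add_assoc, pow_succ, pow_succ, pow_succ]
    rw [pow_add 4] at *
    linear_combination 2 * h - 2 * h' + 4 * this - 12 * 4 ^ s * h16

theorem Gamma_square_i_columns (s : ℕ) (hs : 2 ≤ s) :
    (∀ i, 1 ≤ i → i ≤ s →
      (8 : ℤ) * Gamma s s i i = 2 ^ (2 * s + 2 * i + 1) - 3 * 2 ^ (3 * i - 1) + 2 ^ (2 * i)) ∧
    (∀ i, s + 1 ≤ i → i ≤ 2 * s →
      (Gamma s s i i : ℤ) = 2 ^ (2 * s + 2 * i - 2) - 3 * 2 ^ (3 * i - 4) + 2 ^ (4 * i - 2 * s - 5)) := by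
  constructor
  · intro i hi his
    obtain ⟨k, rfl⟩ := Nat.exists_eq_add_of_le' hi
    have h : (2 * (Gamma s s (k + 1) (k + 1) : ℤ) + 3 * 8 ^ k) = 2 * 4 ^ s * 4 ^ k + 4 ^ k := by
      exact_mod_cast two_mul_Gamma_of_le (s := s) (k := k) (by omega)
    have h4 : ∀ n, (4 : ℤ) ^ n = 2 ^ (2 * n) := fun n => by rw [pow_mul]; norm_num
    have h8 : ∀ n, (8 : ℤ) ^ n = 2 ^ (3 * n) := fun n => by rw [pow_mul]; norm_num
    rw [h4, h4, h8] at h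
    rw [show 2 * s + 2 * (k + 1) + 1 = 2 * s + 2 * k + 3 by ring,
      show 3 * (k + 1) - 1 = 3 * k + 2 by omega, show 2 * (k + 1) = 2 * k + 2 by ring,
      pow_add, pow_add, pow_add, pow_add]
    linear_combination 4 * h
  · intro i hi his
    obtain ⟨e, rfl⟩ := Nat.exists_eq_add_of_le hi
    rw [add_right_comm] at *
    have h : (2 * (Gamma s s (s + e + 1) (s + e + 1) : ℤ) + 3 * 8 ^ (s + e)) =
        2 * 4 ^ s * 4 ^ (s + e) + 4 ^ s * 16 ^ e := by
      exact_mod_cast two_mul_Gamma_of_ge (s := s) (e := e) (by omega)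
    have h4 : ∀ n, (4 : ℤ) ^ n = 2 ^ (2 * n) := fun n => by rw [pow_mul]; norm_num
    have h8 : ∀ n, (8 : ℤ) ^ n = 2 ^ (3 * n) := fun n => by rw [pow_mul]; norm_num
    have h16 : ∀ n, (16 : ℤ) ^ n = 2 ^ (4 * n) := fun n => by rw [pow_mul]; norm_num
    rw [h4, h4, h8, h16] at h
    have e1 : (2 : ℤ) ^ (2 * s + 2 * (s + e + 1) - 2) = 2 ^ (2 * s) * 2 ^ (2 * (s + e)) := by
      rw [← pow_add]
      congr 1
    have e2 : (2 : ℤ) * 2 ^ (3 * (s + e + 1) - 4) = 2 ^ (3 * (s + e)) := by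
      rw [← pow_succ']
      congr 1
      omega
    have e3 : (2 : ℤ) * 2 ^ (4 * (s + e + 1) - 2 * s - 5) = 2 ^ (2 * s) * 2 ^ (4 * e) := by
      rw [← pow_succ', ← pow_add]
      congr 1
      omega
    refine mul_left_cancel₀ (two_ne_zero (α := ℤ)) ?_
    linear_combination h - 2 * e1 + 3 * e2 - e3
end

section
/- Let s ≥ 2, m ≥ 0, 0 ≤ j ≤ s−1 and k ≥ s+m+1+j. Then Γ_{s+m+1+j}^{[s,s+m]×k} = 8^{2j+m} · Γ_{s−j+1}^{[s−j, s−j]×(k−m−2j)}. -/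
open Matrix

open Polynomial

section HankelKernel

variable {F : Type*} [Field F]

/-- The polynomials of degree less than `y` on which all functionals `ℓ i` vanish. -/
noncomputable def coannihilatorLT {ι : Type*} (ℓ : ι → F[X] →ₗ[F] F) (y : ℕ) : Submodule F F[X] :=
  degreeLT F y ⊓ ⨅ i, LinearMap.ker (ℓ i)

theorem mem_coannihilatorLT {ι : Type*} {ℓ : ι → F[X] →ₗ[F] F} {y : ℕ} {v : F[X]} :
    v ∈ coannihilatorLT ℓ y ↔ v ∈ degreeLT F y ∧ ∀ i, ℓ i v = 0 := by
  simp [coannihilatorLT]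

instance {ι : Type*} (ℓ : ι → F[X] →ₗ[F] F) (y : ℕ) :
    FiniteDimensional F (coannihilatorLT ℓ y) :=
  Submodule.finiteDimensional_inf_left _ _

theorem finrank_degreeLT (n : ℕ) : Module.finrank F (degreeLT F n) = n := by
  rw [(degreeLTEquiv F n).finrank_eq, Module.finrank_fin_fun]

theorem finrank_map_of_injective {V W : Type*} [AddCommGroup V] [Module F V] [AddCommGroup W]
    [Module F W] {f : V →ₗ[F] W} (hf : Function.Injective f) (p : Submodule F V) :
    Module.finrank F (p.map f) = Module.finrank F p :=
  (Submodule.equivMapOfInjective f hf p).finrank_eq.symm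

theorem finrank_coannihilatorLT_add_rank {ι : Type*} [Fintype ι] (ℓ : ι → F[X] →ₗ[F] F) (y : ℕ) :
    Module.finrank F (coannihilatorLT ℓ y) +
      (Matrix.of fun i (j : Fin y) => ℓ i (X ^ (j : ℕ))).rank = y := by
  set A : Matrix ι (Fin y) F := Matrix.of fun i (j : Fin y) => ℓ i (X ^ (j : ℕ)) with hA
  set g : (Fin y → F) →ₗ[F] F[X] :=
    (degreeLT F y).subtype ∘ₗ (degreeLTEquiv F y).symm.toLinearMap with hg
  have hginj : Function.Injective g :=
    (degreeLT F y).injective_subtype.comp (degreeLTEquiv F y).symm.injective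
  have hgval : ∀ c, g c = ∑ j : Fin y, c j • (X : F[X]) ^ (j : ℕ) := by
    intro c
    simp [hg, degreeLTEquiv, smul_X_eq_monomial]
  have hmul : ∀ c i, A.mulVecLin c i = ℓ i (g c) := by
    intro c i
    rw [hgval]
    simp [hA, Matrix.mulVec, dotProduct, mul_comm]
  have hmap : (LinearMap.ker A.mulVecLin).map g = coannihilatorLT ℓ y := by
    ext v
    rw [Submodule.mem_map, mem_coannihilatorLT]
    constructor
    · rintro ⟨c, hc, rfl⟩
      refine ⟨((degreeLTEquiv F y).symm c).2, fun i => ?_⟩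
      rw [← hmul, LinearMap.mem_ker.1 hc, Pi.zero_apply]
    · rintro ⟨hv, h⟩
      have hgv : g (degreeLTEquiv F y ⟨v, hv⟩) = v := by simp [hg]
      refine ⟨degreeLTEquiv F y ⟨v, hv⟩, ?_, hgv⟩
      rw [LinearMap.mem_ker]
      ext i
      rw [hmul, hgv, h, Pi.zero_apply]
  rw [← hmap, finrank_map_of_injective hginj, Matrix.rank, add_comm,
    LinearMap.finrank_range_add_finrank_ker, Module.finrank_fin_fun]

/-- The kernel of the `x × y` Hankel matrix of the functional `φ`, as polynomials. -/
noncomputable def hankelKer (φ : F[X] →ₗ[F] F) (x y : ℕ) : Submodule F F[X] :=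
  coannihilatorLT (fun i : Fin x => φ ∘ₗ LinearMap.mulLeft F (X ^ (i : ℕ))) y

theorem mem_hankelKer {φ : F[X] →ₗ[F] F} {x y : ℕ} {v : F[X]} :
    v ∈ hankelKer φ x y ↔ v ∈ degreeLT F y ∧ ∀ i < x, φ (X ^ i * v) = 0 := by
  simp only [hankelKer, mem_coannihilatorLT, LinearMap.comp_apply, LinearMap.mulLeft_apply]
  exact and_congr_right fun _ => ⟨fun h i hi => h ⟨i, hi⟩, fun h i => h i i.2⟩

instance (φ : F[X] →ₗ[F] F) (x y : ℕ) : FiniteDimensional F (hankelKer φ x y) :=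
  inferInstanceAs (FiniteDimensional F (coannihilatorLT _ y))

theorem finrank_hankelKer_add_rank (φ : F[X] →ₗ[F] F) (x y : ℕ) :
    Module.finrank F (hankelKer φ x y) +
      (Matrix.of fun (i : Fin x) (j : Fin y) => φ (X ^ ((i : ℕ) + j))).rank = y := by
  have := finrank_coannihilatorLT_add_rank
    (fun i : Fin x => φ ∘ₗ LinearMap.mulLeft F (X ^ (i : ℕ))) y
  simp only [LinearMap.comp_apply, LinearMap.mulLeft_apply, ← pow_add] at this
  exact this

theorem finrank_hankelKer_add_comm (φ : F[X] →ₗ[F] F) (x y : ℕ) :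
    Module.finrank F (hankelKer φ x y) + x = Module.finrank F (hankelKer φ y x) + y := by
  have h1 := finrank_hankelKer_add_rank φ x y
  have h2 := finrank_hankelKer_add_rank φ y x
  have h3 : (Matrix.of fun (i : Fin x) (j : Fin y) => φ (X ^ ((i : ℕ) + j))).rank =
      (Matrix.of fun (i : Fin y) (j : Fin x) => φ (X ^ ((i : ℕ) + j))).rank := by
    rw [← Matrix.rank_transpose]
    congr 1
    ext i j
    simp [add_comm]
  omega

theorem X_pow_mul_mem_degreeLT_s12 {p : F[X]} {i n m : ℕ} (hp : p ∈ degreeLT F n) (h : i + n ≤ m) :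
    X ^ i * p ∈ degreeLT F m := by
  rw [mem_degreeLT, degree_lt_iff_coeff_zero] at *
  intro j hj
  rw [coeff_X_pow_mul', if_pos (by omega)]
  exact hp _ (by omega)

theorem mul_mem_degreeLT {p v : F[X]} {m n k : ℕ} (hv : v ∈ degreeLT F (m + 1))
    (hp : p ∈ degreeLT F n) (h : m + n ≤ k) : v * p ∈ degreeLT F k := by
  rcases eq_or_ne p 0 with rfl | hp0
  · simp
  rcases eq_or_ne v 0 with rfl | hv0
  · simp
  rw [mem_degreeLT, ← natDegree_lt_iff_degree_lt (by assumption)] at hv hp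
  rw [mem_degreeLT, ← natDegree_lt_iff_degree_lt (mul_ne_zero hv0 hp0), natDegree_mul hv0 hp0]
  omega

theorem hankelKer_mono (φ : F[X] →ₗ[F] F) {x y x' y' : ℕ} (hx : x' ≤ x) (hy : y ≤ y') :
    hankelKer φ x y ≤ hankelKer φ x' y' := by
  intro v
  rw [mem_hankelKer, mem_hankelKer]
  exact fun h => ⟨degreeLT_mono hy h.1, fun i hi => h.2 i (by omega)⟩

theorem mul_mem_hankelKer {φ : F[X] →ₗ[F] F} {x y x' y' n : ℕ} {v p : F[X]}
    (hv : v ∈ hankelKer φ x (y + 1)) (hp : p ∈ degreeLT F n) (hx : x' + n ≤ x + 1)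
    (hy : y + n ≤ y') : v * p ∈ hankelKer φ x' y' := by
  rw [mem_hankelKer] at hv ⊢
  refine ⟨mul_mem_degreeLT hv.1 hp hy, fun i hi => ?_⟩
  rw [mem_degreeLT, degree_lt_iff_coeff_zero] at hp
  rw [p.as_sum_range' _ (Nat.lt_succ_self _), Finset.mul_sum, Finset.mul_sum, map_sum]
  refine Finset.sum_eq_zero fun j _ => ?_
  by_cases hj : j < n
  · rw [← smul_X_eq_monomial, show X ^ i * (v * p.coeff j • X ^ j) =
      p.coeff j • (X ^ (i + j) * v) by simp only [smul_eq_C_mul]; ring, map_smul,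
      hv.2 _ (by omega), smul_zero]
  · simp [hp j (by omega)]

theorem mulLeft_injective {v : F[X]} (hv : v ≠ 0) : Function.Injective (LinearMap.mulLeft F v) :=
  fun _ _ h => mul_left_cancel₀ hv h

theorem X_mul_mem_hankelKer {φ : F[X] →ₗ[F] F} {x y : ℕ} {v : F[X]}
    (hv : v ∈ hankelKer φ (x + 1) y) : X * v ∈ hankelKer φ x (y + 1) := by
  rw [mem_hankelKer] at hv ⊢
  refine ⟨by simpa using X_pow_mul_mem_degreeLT_s12 (i := 1) (m := y + 1) hv.1 (by omega),
    fun i hi => ?_⟩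
  rw [← mul_assoc, ← pow_succ]
  exact hv.2 _ (by omega)

/-- The span of a Hankel kernel and its shift. -/
theorem finrank_hankelKer_sup_shift (φ : F[X] →ₗ[F] F) (x y : ℕ) :
    Module.finrank F ↥(hankelKer φ (x + 1) (y + 1) ⊔
        (hankelKer φ (x + 1) (y + 1)).map (LinearMap.mulLeft F X)) +
      Module.finrank F (hankelKer φ (x + 2) y) =
    2 * Module.finrank F (hankelKer φ (x + 1) (y + 1)) := by
  have hinf : hankelKer φ (x + 1) (y + 1) ⊓
      (hankelKer φ (x + 1) (y + 1)).map (LinearMap.mulLeft F X) =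
      (hankelKer φ (x + 2) y).map (LinearMap.mulLeft F X) := by
    ext v
    simp only [Submodule.mem_inf, Submodule.mem_map, LinearMap.mulLeft_apply]
    constructor
    · rintro ⟨hv, w, hw, rfl⟩
      refine ⟨w, ?_, rfl⟩
      rw [mem_hankelKer] at hv hw ⊢
      constructor
      · rw [mem_degreeLT, degree_lt_iff_coeff_zero]
        intro j hj
        have := hv.1
        rw [mem_degreeLT, degree_lt_iff_coeff_zero] at this
        simpa using this (j + 1) (by omega)
      · intro i hi
        rcases Nat.lt_or_ge i (x + 1) with h | h
        · exact hw.2 i h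
        · have := hv.2 x (by omega)
          rwa [← mul_assoc, ← pow_succ, show x + 1 = i by omega] at this
    · rintro ⟨w, hw, rfl⟩
      exact ⟨X_mul_mem_hankelKer hw, w, hankelKer_mono φ (by omega) (by omega) hw, rfl⟩
  have h := Submodule.finrank_sup_add_finrank_inf_eq (hankelKer φ (x + 1) (y + 1))
    ((hankelKer φ (x + 1) (y + 1)).map (LinearMap.mulLeft F X))
  rw [hinf, finrank_map_of_injective (mulLeft_injective X_ne_zero),
    finrank_map_of_injective (mulLeft_injective X_ne_zero)] at h
  omega

theorem hankelKer_sup_shift_le (φ : F[X] →ₗ[F] F) (x y : ℕ) :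
    hankelKer φ (x + 1) y ⊔ (hankelKer φ (x + 1) y).map (LinearMap.mulLeft F X) ≤
      hankelKer φ x (y + 1) := by
  refine sup_le (hankelKer_mono φ (by omega) (by omega)) ?_
  rintro _ ⟨w, hw, rfl⟩
  exact X_mul_mem_hankelKer hw

theorem finrank_hankelKer_convex (φ : F[X] →ₗ[F] F) (x y : ℕ) :
    2 * Module.finrank F (hankelKer φ (x + 1) (y + 1)) ≤
      Module.finrank F (hankelKer φ (x + 2) y) + Module.finrank F (hankelKer φ x (y + 2)) := by
  rw [← finrank_hankelKer_sup_shift, add_comm]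
  exact Nat.add_le_add_left (Submodule.finrank_mono (hankelKer_sup_shift_le φ x (y + 1))) _

/-- `r` is the largest size for which the kernel of the `(M - r) × r` Hankel matrix vanishes. -/
structure IsHankelType (φ : F[X] →ₗ[F] F) (M r : ℕ) : Prop where
  lt : r < M
  eq_bot : hankelKer φ (M - r) r = ⊥
  ne_bot : hankelKer φ (M - (r + 1)) (r + 1) ≠ ⊥

namespace IsHankelType

variable {φ : F[X] →ₗ[F] F} {M r : ℕ}

theorem finrank_top (h : IsHankelType φ M r) {y : ℕ} (hy : M - r ≤ y) (hyM : y ≤ M) :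
    Module.finrank F (hankelKer φ (M - y) y) + M = 2 * y := by
  have h1 := finrank_hankelKer_add_comm φ (M - y) y
  have h2 : hankelKer φ y (M - y) = ⊥ :=
    le_bot_iff.1 (h.eq_bot ▸ hankelKer_mono φ (by omega) (by omega))
  rw [h2, finrank_bot] at h1
  omega

theorem two_mul_le (h : IsHankelType φ M r) : 2 * r ≤ M := by
  have := h.finrank_top le_rfl (Nat.sub_le _ _)
  have := h.lt
  omega

theorem finrank_succ_le (h : IsHankelType φ M r) {y : ℕ} (hy : r ≤ y) (hyM : y + 1 ≤ M) :
    Module.finrank F (hankelKer φ (M - y) y) + 1 ≤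
      Module.finrank F (hankelKer φ (M - (y + 1)) (y + 1)) := by
  induction y, hy using Nat.le_induction with
  | base =>
    rw [h.eq_bot, finrank_bot]
    exact Nat.one_le_iff_ne_zero.2 fun h0 => h.ne_bot (Submodule.finrank_eq_zero.1 h0)
  | succ y hy ih =>
    have h1 := ih (by omega)
    have h2 := finrank_hankelKer_convex φ (M - (y + 2)) y
    rw [show M - (y + 2) + 1 = M - (y + 1) by omega, show M - (y + 2) + 2 = M - y by omega] at h2
    rw [show y + 1 + 1 = y + 2 by omega]
    omega

theorem finrank_add_le (h : IsHankelType φ M r) {y : ℕ} (hy : r ≤ y) (n : ℕ) (hn : y + n ≤ M) :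
    Module.finrank F (hankelKer φ (M - y) y) + n ≤
      Module.finrank F (hankelKer φ (M - (y + n)) (y + n)) := by
  induction n with
  | zero => simp
  | succ n ih =>
    have h1 := ih (by omega)
    have h2 := h.finrank_succ_le (y := y + n) (by omega) (by omega)
    rw [← add_assoc y n 1]
    omega

theorem finrank_mid (h : IsHankelType φ M r) {y : ℕ} (hy : r ≤ y) (hyM : y ≤ M - r) :
    Module.finrank F (hankelKer φ (M - y) y) = y - r := by
  have h0 := h.finrank_add_le le_rfl (y - r) (by omega)
  have h1 := h.finrank_add_le hy (M - r - y) (by omega)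
  have h2 := h.finrank_top le_rfl (Nat.sub_le _ _)
  rw [show r + (y - r) = y by omega] at h0
  rw [show y + (M - r - y) = M - r by omega] at h1
  omega

end IsHankelType

instance finiteDimensional_submodule_prod {V W : Type*} [AddCommGroup V] [Module F V]
    [AddCommGroup W] [Module F W] (p : Submodule F V) (q : Submodule F W) [FiniteDimensional F p]
    [FiniteDimensional F q] : FiniteDimensional F (p.prod q) := by
  have : p.prod q = LinearMap.range (p.subtype.prodMap q.subtype) := by
    rw [LinearMap.range_prodMap, p.range_subtype, q.range_subtype]
  rw [this]
  infer_instance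

theorem finrank_submodule_prod {V W : Type*} [AddCommGroup V] [Module F V] [AddCommGroup W]
    [Module F W] (p : Submodule F V) (q : Submodule F W) [FiniteDimensional F p]
    [FiniteDimensional F q] :
    Module.finrank F (p.prod q) = Module.finrank F p + Module.finrank F q := by
  have hinj : Function.Injective (p.subtype.prodMap q.subtype) :=
    Function.Injective.prodMap p.injective_subtype q.injective_subtype
  rw [← Module.finrank_prod, ← LinearMap.finrank_range_of_inj hinj, LinearMap.range_prodMap,
    p.range_subtype, q.range_subtype]

/-- The map `(p, q) ↦ v p + w q`. -/
noncomputable def combine (v w : F[X]) : F[X] × F[X] →ₗ[F] F[X] :=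
  (LinearMap.mulLeft F v).coprod (LinearMap.mulLeft F w)

@[simp] theorem combine_apply (v w : F[X]) (z : F[X] × F[X]) :
    combine v w z = v * z.1 + w * z.2 := rfl

/-- Pairs of polynomials of degrees less than `m` and `n`. -/
noncomputable abbrev degreeLTProd (F : Type*) [Field F] (m n : ℕ) : Submodule F (F[X] × F[X]) :=
  (degreeLT F m).prod (degreeLT F n)

namespace IsHankelType

variable {φ : F[X] →ₗ[F] F} {M r : ℕ}

/-- The Hankel kernels of a functional of type `r` are freely generated by two polynomials. -/
theorem exists_generators (h : IsHankelType φ M r) :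
    ∃ v w : F[X], v ∈ degreeLT F (r + 1) ∧ w ∈ degreeLT F (M - r + 1) ∧
      (∀ y ≤ M, hankelKer φ (M - y) y =
        (degreeLTProd F (y - r) (y - (M - r))).map (combine v w)) ∧
      Disjoint (degreeLTProd F (M - r) r) (LinearMap.ker (combine v w)) := by
  have hr := h.two_mul_le
  have hlt := h.lt
  obtain ⟨v, hv, hv0⟩ := (Submodule.ne_bot_iff _).1 h.ne_bot
  have hvK : ∀ y ≤ M, r ≤ y → (degreeLT F (y - r)).map (LinearMap.mulLeft F v) ≤
      hankelKer φ (M - y) y := by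
    rintro y hy hry _ ⟨p, hp, rfl⟩
    exact mul_mem_hankelKer hv hp (by omega) (by omega)
  have hmid : ∀ y, r ≤ y → y ≤ M - r → (degreeLT F (y - r)).map (LinearMap.mulLeft F v) =
      hankelKer φ (M - y) y := by
    intro y hry hy
    refine Submodule.eq_of_le_of_finrank_eq (hvK y (by omega) hry) ?_
    rw [finrank_map_of_injective (mulLeft_injective hv0), finrank_degreeLT, h.finrank_mid hry hy]
  obtain ⟨w, hw, hwtop⟩ : ∃ w ∈ degreeLT F (M - r + 1), ∀ y ≤ M, M - r < y →
      hankelKer φ (M - y) y = (degreeLTProd F (y - r) (y - (M - r))).map (combine v w) := by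
    rcases Nat.eq_zero_or_pos r with rfl | hr0
    · exact ⟨0, zero_mem _, fun y hy hy' => by omega⟩
    have hdim := h.finrank_top (y := M - r + 1) (by omega) (by omega)
    obtain ⟨w, hw, hwv⟩ : ∃ w ∈ hankelKer φ (M - (M - r + 1)) (M - r + 1),
        w ∉ (degreeLT F (M - r + 1 - r)).map (LinearMap.mulLeft F v) := by
      by_contra! hcon
      have := Submodule.finrank_mono (R := F) (s := hankelKer φ (M - (M - r + 1)) (M - r + 1)) hcon
      rw [finrank_map_of_injective (mulLeft_injective hv0), finrank_degreeLT] at this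
      omega
    refine ⟨w, (mem_hankelKer.1 hw).1, fun y hy hy' => ?_⟩
    apply le_antisymm
    · induction y, (show M - r + 1 ≤ y from hy') using Nat.le_induction with
      | base =>
        have hle : (degreeLT F (M - r + 1 - r)).map (LinearMap.mulLeft F v) <
            (degreeLTProd F (M - r + 1 - r) (M - r + 1 - (M - r))).map (combine v w) := by
          refine lt_of_le_of_ne ?_ fun heq => hwv ?_
          · rintro _ ⟨p, hp, rfl⟩
            exact ⟨(p, 0), ⟨hp, zero_mem _⟩, by simp⟩
          · rw [heq]
            refine ⟨(0, 1), ⟨zero_mem _, ?_⟩, by simp⟩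
            rw [SetLike.mem_coe, mem_degreeLT, degree_one]
            exact_mod_cast (by omega : 0 < M - r + 1 - (M - r))
        have hle2 : (degreeLTProd F (M - r + 1 - r) (M - r + 1 - (M - r))).map (combine v w) ≤
            hankelKer φ (M - (M - r + 1)) (M - r + 1) := by
          rintro _ ⟨⟨p, q⟩, ⟨hp, hq⟩, rfl⟩
          exact add_mem (hvK _ hy (by omega) ⟨p, hp, rfl⟩)
            (mul_mem_hankelKer hw hq (by omega) (by omega))
        have hfd := Submodule.finiteDimensional_of_le hle2
        have hlt := Submodule.finrank_lt_finrank_of_lt hle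
        rw [finrank_map_of_injective (mulLeft_injective hv0), finrank_degreeLT] at hlt
        exact (Submodule.eq_of_le_of_finrank_le hle2 (by omega)).ge
      | succ y hy1 ih =>
        have hsup : hankelKer φ (M - y) y ⊔
            (hankelKer φ (M - y) y).map (LinearMap.mulLeft F X) =
            hankelKer φ (M - (y + 1)) (y + 1) := by
          have h1 := hankelKer_sup_shift_le φ (M - (y + 1)) y
          have h2 := finrank_hankelKer_sup_shift φ (M - (y + 1)) (y - 1)
          rw [show M - (y + 1) + 1 = M - y by omega] at h1 h2
          rw [show y - 1 + 1 = y by omega, show M - (y + 1) + 2 = M - (y - 1) by omega] at h2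
          refine Submodule.eq_of_le_of_finrank_eq h1 ?_
          have h3 := h.finrank_top (y := y) (by omega) (by omega)
          have h4 := h.finrank_top (y := y - 1) (by omega) (by omega)
          have h5 := h.finrank_top (y := y + 1) (by omega) (by omega)
          omega
        have ih' := ih (by omega) (by omega)
        rw [← hsup]
        refine sup_le (ih'.trans (Submodule.map_mono (Submodule.prod_mono
          (degreeLT_mono (by omega)) (degreeLT_mono (by omega))))) ?_
        refine (Submodule.map_mono ih').trans ?_
        rintro _ ⟨_, ⟨⟨p, q⟩, ⟨hp, hq⟩, rfl⟩, rfl⟩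
        refine ⟨(X ^ 1 * p, X ^ 1 * q), ⟨X_pow_mul_mem_degreeLT_s12 hp (by omega),
          X_pow_mul_mem_degreeLT_s12 hq (by omega)⟩, ?_⟩
        simp only [combine_apply, LinearMap.mulLeft_apply]
        ring
    · rintro _ ⟨⟨p, q⟩, ⟨hp, hq⟩, rfl⟩
      exact add_mem (hvK y hy (by omega) ⟨p, hp, rfl⟩)
        (mul_mem_hankelKer hw hq (by omega) (by omega))
  have hgen : ∀ y ≤ M, hankelKer φ (M - y) y =
      (degreeLTProd F (y - r) (y - (M - r))).map (combine v w) := by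
    intro y hy
    rcases Nat.lt_or_ge (M - r) y with hy' | hy'
    · exact hwtop y hy hy'
    have hcol : (degreeLTProd F (y - r) (y - (M - r))).map (combine v w) =
        (degreeLT F (y - r)).map (LinearMap.mulLeft F v) := by
      rw [show y - (M - r) = 0 by omega]
      ext u
      simp [Submodule.mem_map, mem_degreeLT]
    rw [hcol]
    rcases Nat.lt_or_ge y r with hyr | hyr
    · have : hankelKer φ (M - y) y = ⊥ :=
        le_bot_iff.1 (h.eq_bot ▸ hankelKer_mono φ (by omega) (by omega))
      rw [this, show y - r = 0 by omega]
      symm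
      rw [eq_bot_iff]
      rintro _ ⟨p, hp, rfl⟩
      have : p = 0 := by simpa [mem_degreeLT] using hp
      simp [this]
    · exact (hmid y hyr hy').symm
  refine ⟨v, w, (mem_hankelKer.1 hv).1, hw, hgen, ?_⟩
  have h1 := hgen M le_rfl
  have h2 := h.finrank_top (y := M) (by omega) le_rfl
  rw [h1, show M - (M - r) = r by omega, ← LinearMap.range_domRestrict] at h2
  have h3 := LinearMap.finrank_range_add_finrank_ker
    ((combine v w).domRestrict (degreeLTProd F (M - r) r))
  rw [finrank_submodule_prod, finrank_degreeLT, finrank_degreeLT] at h3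
  rw [← LinearMap.injective_domRestrict_iff, ← LinearMap.ker_eq_bot]
  exact Submodule.finrank_eq_zero.1 (by omega)

end IsHankelType

/-- The functional on polynomials whose value at `X ^ i` is `c i` for `i < n`, and zero otherwise. -/
noncomputable def seqFunctional {n : ℕ} (c : Fin n → F) : F[X] →ₗ[F] F :=
  ∑ i : Fin n, c i • lcoeff F (i : ℕ)

theorem seqFunctional_apply {n : ℕ} (c : Fin n → F) (p : F[X]) :
    seqFunctional c p = ∑ i : Fin n, c i * p.coeff i := by
  simp [seqFunctional]

theorem seqFunctional_X_pow {n : ℕ} (c : Fin n → F) {j : ℕ} (hj : j < n) :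
    seqFunctional c (X ^ j) = c ⟨j, hj⟩ := by
  rw [seqFunctional_apply, Finset.sum_eq_single ⟨j, hj⟩]
  · simp
  · intro i _ hi
    rw [coeff_X_pow, if_neg (fun h => hi (Fin.ext h)), mul_zero]
  · simp

theorem sum_coeff_smul_X_pow {n : ℕ} {p : F[X]} (hp : p ∈ degreeLT F n) :
    ∑ i : Fin n, p.coeff i • (X : F[X]) ^ (i : ℕ) = p := by
  simp only [smul_X_eq_monomial]
  rw [Fin.sum_univ_eq_sum_range (fun i => monomial i (p.coeff i))]
  rcases eq_or_ne p 0 with rfl | h0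
  · simp
  exact (p.as_sum_range' n (by
    rwa [mem_degreeLT, ← natDegree_lt_iff_degree_lt h0] at hp)).symm

theorem seqFunctional_comp_mul (φ : F[X] →ₗ[F] F) (v : F[X]) {n : ℕ} {p : F[X]}
    (hp : p ∈ degreeLT F n) :
    seqFunctional (fun i : Fin n => φ (v * X ^ (i : ℕ))) p = φ (v * p) := by
  conv_rhs => rw [← sum_coeff_smul_X_pow hp]
  simp [seqFunctional_apply, Finset.mul_sum, mul_comm]

/-- The values of the functional of a sequence at the polynomials `u j`. -/
noncomputable def seqEval (n : ℕ) {J : Type*} (u : J → F[X]) : (Fin n → F) →ₗ[F] (J → F) where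
  toFun c j := seqFunctional c (u j)
  map_add' c c' := by
    ext j
    simp [seqFunctional_apply, add_mul, Finset.sum_add_distrib]
  map_smul' t c := by
    ext j
    simp [seqFunctional_apply, Finset.mul_sum, mul_assoc]

theorem seqEval_apply {n : ℕ} {J : Type*} (u : J → F[X]) (c : Fin n → F) (j : J) :
    seqEval n u c j = seqFunctional c (u j) := rfl

theorem seqEval_surjective {n : ℕ} {J : Type*} [Fintype J] {u : J → F[X]}
    (hu : LinearIndependent F u) (hn : ∀ j, u j ∈ degreeLT F n) :
    Function.Surjective (seqEval n u) := by
  set A : Matrix J (Fin n) F := Matrix.of fun j i => (u j).coeff i with hA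
  have hlin : LinearIndependent F A.row := by
    rw [Fintype.linearIndependent_iff] at hu ⊢
    intro g hg
    refine hu g ?_
    ext i
    rcases Nat.lt_or_ge i n with hi | hi
    · simpa [hA, finsetSum_coeff] using congrFun hg ⟨i, hi⟩
    · have hmem : ∑ j, g j • u j ∈ degreeLT F n :=
        Submodule.sum_mem _ fun j _ => Submodule.smul_mem _ _ (hn j)
      rw [mem_degreeLT, degree_lt_iff_coeff_zero] at hmem
      simpa using hmem i hi
  have hrange : LinearMap.range A.mulVecLin = ⊤ := by
    apply Submodule.eq_top_of_finrank_eq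
    rw [Module.finrank_fintype_fun_eq_card]
    exact hlin.rank_matrix
  intro γ
  obtain ⟨c, hc⟩ := LinearMap.range_eq_top.1 hrange γ
  refine ⟨c, ?_⟩
  rw [← hc]
  ext j
  simp [seqEval_apply, seqFunctional_apply, hA, Matrix.mulVec, dotProduct, mul_comm]

theorem card_subtype_comp_of_surjective {V W : Type*} [AddCommGroup V] [Module F V]
    [AddCommGroup W] [Module F W] {T : V →ₗ[F] W} (hT : Function.Surjective T) (P : W → Prop) :
    Nat.card {x // P (T x)} = Nat.card (LinearMap.ker T) * Nat.card {z // P z} := by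
  obtain ⟨s, hs⟩ := hT.hasRightInverse
  rw [← Nat.card_prod]
  refine Nat.card_congr
    { toFun := fun x => (⟨x.1 - s (T x.1), by simp [hs (T x.1)]⟩, ⟨T x.1, x.2⟩)
      invFun := fun z => ⟨z.1.1 + s z.2.1, by
        rw [map_add, LinearMap.mem_ker.1 z.1.2, hs, zero_add]
        exact z.2.2⟩
      left_inv := fun x => by simp
      right_inv := fun z => ?_ }
  have hz : T (z.1.1 + s z.2.1) = z.2.1 := by
    rw [map_add, LinearMap.mem_ker.1 z.1.2, hs, zero_add]
  ext
  · simp [hz]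
  · simp [hz]

theorem card_seqEval {n : ℕ} {J : Type*} [Fintype J] [Finite F] {u : J → F[X]}
    (hu : LinearIndependent F u) (hn : ∀ j, u j ∈ degreeLT F n)
    (P : (J → F) → Prop) :
    Nat.card {c : Fin n → F // P (seqEval n u c)} =
      Nat.card F ^ (n - Fintype.card J) * Nat.card {γ // P γ} := by
  have hsurj := seqEval_surjective hu hn
  rw [card_subtype_comp_of_surjective hsurj, Module.natCard_eq_pow_finrank (K := F)]
  have h := LinearMap.finrank_range_add_finrank_ker (seqEval n u)
  rw [LinearMap.range_eq_top.2 hsurj, finrank_top, Module.finrank_fintype_fun_eq_card,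
    Module.finrank_fin_fun] at h
  rw [show n - Fintype.card J = Module.finrank F (LinearMap.ker (seqEval n u)) by omega]

theorem finrank_inf_add_rank_fromRows (φ ψ : F[X] →ₗ[F] F) (a b k : ℕ) :
    Module.finrank F ↥(hankelKer φ a k ⊓ hankelKer ψ b k) +
      (Matrix.fromRows (Matrix.of fun (i : Fin a) (j : Fin k) => φ (X ^ ((i : ℕ) + j)))
        (Matrix.of fun (i : Fin b) (j : Fin k) => ψ (X ^ ((i : ℕ) + j)))).rank = k := by
  set ℓ : Fin a ⊕ Fin b → F[X] →ₗ[F] F := Sum.elim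
    (fun i : Fin a => φ ∘ₗ LinearMap.mulLeft F (X ^ (i : ℕ)))
    (fun i : Fin b => ψ ∘ₗ LinearMap.mulLeft F (X ^ (i : ℕ))) with hℓ
  have hker : hankelKer φ a k ⊓ hankelKer ψ b k = coannihilatorLT ℓ k := by
    ext v
    simp only [Submodule.mem_inf, hankelKer, mem_coannihilatorLT, hℓ, Sum.forall, Sum.elim_inl,
      Sum.elim_inr]
    tauto
  have hmat : Matrix.fromRows (Matrix.of fun (i : Fin a) (j : Fin k) => φ (X ^ ((i : ℕ) + j)))
      (Matrix.of fun (i : Fin b) (j : Fin k) => ψ (X ^ ((i : ℕ) + j))) =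
      Matrix.of fun i (j : Fin k) => ℓ i (X ^ (j : ℕ)) := by
    ext i j
    rcases i with i | i <;> simp [hℓ, pow_add]
  rw [hker, hmat, finrank_coannihilatorLT_add_rank]

/-- The kernel of the `a × (C + d)` matrix formed by two Hankel blocks side by side. -/
noncomputable def blockKer (a C d : ℕ) {A B : ℕ} (γ : Fin A ⊕ Fin B → F) :
    Submodule F (F[X] × F[X]) :=
  degreeLTProd F C d ⊓ ⨅ i : Fin a, LinearMap.ker
    ((seqFunctional (γ ∘ Sum.inl)).coprod (seqFunctional (γ ∘ Sum.inr)) ∘ₗ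
      (LinearMap.mulLeft F (X ^ (i : ℕ))).prodMap (LinearMap.mulLeft F (X ^ (i : ℕ))))

theorem mem_blockKer {a C d A B : ℕ} {γ : Fin A ⊕ Fin B → F} {z : F[X] × F[X]} :
    z ∈ blockKer a C d γ ↔ z ∈ degreeLTProd F C d ∧ ∀ i < a,
      seqFunctional (γ ∘ Sum.inl) (X ^ i * z.1) + seqFunctional (γ ∘ Sum.inr) (X ^ i * z.2) = 0 := by
  simp only [blockKer, Submodule.mem_inf, Submodule.mem_iInf, LinearMap.mem_ker,
    LinearMap.comp_apply, LinearMap.prodMap_apply, LinearMap.coprod_apply,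
    LinearMap.mulLeft_apply]
  exact and_congr_right fun _ => ⟨fun h i hi => h ⟨i, hi⟩, fun h i => h i i.2⟩

instance {a C d A B : ℕ} (γ : Fin A ⊕ Fin B → F) : FiniteDimensional F (blockKer a C d γ) :=
  Submodule.finiteDimensional_inf_left _ _

/-- The number of pairs of Hankel blocks, of sizes `a × C` and `a × d`, with joint nullity `n`. -/
noncomputable def blockCount (F : Type*) [Field F] (a C d n : ℕ) : ℕ :=
  Nat.card {γ : Fin (a + C - 1) ⊕ Fin (if d = 0 then 0 else a + d - 1) → F //
    Module.finrank F (blockKer a C d γ) = n}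

theorem blockCount_eq_zero [Finite F] {a C n : ℕ} (h : n + a < C) : blockCount F a C 0 n = 0 := by
  rw [blockCount, Nat.card_eq_zero]
  refine Or.inl ⟨fun ⟨γ, hγ⟩ => ?_⟩
  have hle : (hankelKer (seqFunctional (γ ∘ Sum.inl)) a C).map
      (LinearMap.inl F F[X] F[X]) ≤ blockKer a C 0 γ := by
    rintro _ ⟨p, hp, rfl⟩
    rw [SetLike.mem_coe, mem_hankelKer] at hp
    rw [mem_blockKer]
    exact ⟨⟨hp.1, zero_mem _⟩, fun i hi => by simp [hp.2 i hi]⟩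
  have h1 := Submodule.finrank_mono hle
  rw [finrank_map_of_injective LinearMap.inl_injective, hγ] at h1
  have h2 := finrank_hankelKer_add_rank (seqFunctional (γ ∘ Sum.inl)) a C
  have h3 := Matrix.rank_le_card_height (Matrix.of fun (i : Fin a) (j : Fin C) =>
    seqFunctional (γ ∘ Sum.inl) (X ^ ((i : ℕ) + j)))
  rw [Fintype.card_fin] at h3
  omega

theorem linearIndependent_combine {m n A B : ℕ} {v w : F[X]}
    (hdisj : Disjoint (degreeLTProd F m n) (LinearMap.ker (combine v w))) (hA : A ≤ m)
    (hB : B ≤ n) :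
    LinearIndependent F (Sum.elim (fun i : Fin A => v * X ^ (i : ℕ))
      (fun j : Fin B => w * X ^ (j : ℕ))) := by
  rw [Fintype.linearIndependent_iff]
  intro g hg
  have hmem : ∀ {D E : ℕ} (f : Fin D → F), D ≤ E →
      ∑ i, f i • (X : F[X]) ^ (i : ℕ) ∈ degreeLT F E := by
    intro D E f hDE
    refine Submodule.sum_mem _ fun i _ => Submodule.smul_mem _ _ ?_
    rw [mem_degreeLT, degree_X_pow]
    exact_mod_cast i.isLt.trans_le hDE
  have hz : (∑ i : Fin A, g (.inl i) • (X : F[X]) ^ (i : ℕ),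
      ∑ j : Fin B, g (.inr j) • (X : F[X]) ^ (j : ℕ)) = 0 := by
    refine Submodule.disjoint_def.1 hdisj _ ⟨hmem _ hA, hmem _ hB⟩ ?_
    rw [LinearMap.mem_ker, combine_apply, ← hg, Fintype.sum_sum_type]
    simp [Finset.mul_sum]
  have hcoeff : ∀ {D : ℕ} (f : Fin D → F), ∑ i, f i • (X : F[X]) ^ (i : ℕ) = 0 → ∀ i, f i = 0 := by
    intro D f hf i
    have := congrArg (fun p => coeff p (i : ℕ)) hf
    simp only [finsetSum_coeff, coeff_smul, coeff_X_pow, smul_eq_mul, coeff_zero] at this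
    simpa [Fin.ext_iff.symm] using this
  rintro (i | j)
  · exact hcoeff _ (congrArg Prod.fst hz) i
  · exact hcoeff _ (congrArg Prod.snd hz) j

theorem IsHankelType.card_finrank_inf_eq [Finite F] {a b k r n : ℕ} {ψ : F[X] →ₗ[F] F}
    (h : IsHankelType ψ (b + k) r) (hbk : b < k) (hab : a ≤ b + 1) :
    Nat.card {α : Fin (a + k - 1) → F //
      Module.finrank F ↥(hankelKer (seqFunctional α) a k ⊓ hankelKer ψ b k) = n} =
    Nat.card F ^ (if r ≤ b then r else b + 1 - a) * blockCount F a (k - r) (r - b) n := by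
  have hr := h.two_mul_le
  obtain ⟨v, w, hv, hw, hgen, hdisj⟩ := h.exists_generators
  have hk := hgen k (by omega)
  rw [show b + k - k = b by omega, show k - (b + k - r) = r - b by omega] at hk
  set A := a + (k - r) - 1 with hA
  set B := if r - b = 0 then 0 else a + (r - b) - 1 with hB
  have hAle : A ≤ b + k - r := by omega
  have hBle : B ≤ r := by
    rw [hB]
    split_ifs <;> omega
  set u : Fin A ⊕ Fin B → F[X] := Sum.elim (fun i : Fin A => v * X ^ (i : ℕ))
      (fun j : Fin B => w * X ^ (j : ℕ)) with hu
  have hlin : LinearIndependent F u := linearIndependent_combine hdisj hAle hBle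
  have hmem : ∀ j, u j ∈ degreeLT F (a + k - 1) := by
    have hX : ∀ i : ℕ, (X : F[X]) ^ i ∈ degreeLT F (i + 1) := by
      intro i
      rw [mem_degreeLT, degree_X_pow]
      exact_mod_cast i.lt_succ_self
    rintro (i | j)
    · have := i.isLt
      exact mul_mem_degreeLT hv (hX i) (by omega)
    · have h1 := j.isLt
      have h2 : B ≤ a + (r - b) - 1 ∧ r - b ≠ 0 := by
        split_ifs at hB <;> omega
      exact mul_mem_degreeLT hw (hX j) (by omega)
  have hfin : ∀ α : Fin (a + k - 1) → F,
      Module.finrank F ↥(hankelKer (seqFunctional α) a k ⊓ hankelKer ψ b k) =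
      Module.finrank F (blockKer a (k - r) (r - b) (seqEval (a + k - 1) u α)) := by
    intro α
    have hval : ∀ z ∈ degreeLTProd F (k - r) (r - b), ∀ i < a,
        seqFunctional (seqEval (a + k - 1) u α ∘ Sum.inl) (X ^ i * z.1) +
          seqFunctional (seqEval (a + k - 1) u α ∘ Sum.inr) (X ^ i * z.2) =
        seqFunctional α (X ^ i * combine v w z) := by
      rintro ⟨p, q⟩ ⟨hp, hq⟩ i hi
      have h1 : X ^ i * p ∈ degreeLT F A := X_pow_mul_mem_degreeLT_s12 hp (by omega)
      have h2 : X ^ i * q ∈ degreeLT F B := by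
        by_cases h0 : r - b = 0
        · have : q = 0 := by simpa [mem_degreeLT, h0] using hq
          simp [this]
        · refine X_pow_mul_mem_degreeLT_s12 hq ?_
          rw [hB, if_neg h0]
          omega
      have h3 := seqFunctional_comp_mul (seqFunctional α) v h1
      have h4 := seqFunctional_comp_mul (seqFunctional α) w h2
      refine (congrArg₂ (· + ·) h3 h4).trans ?_
      rw [← map_add, combine_apply]
      congr 1
      ring
    have hle : blockKer a (k - r) (r - b) (seqEval (a + k - 1) u α) ≤
        degreeLTProd F (b + k - r) r :=
      inf_le_left.trans (Submodule.prod_mono (degreeLT_mono (by omega)) (degreeLT_mono (by omega)))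
    have hmap : hankelKer (seqFunctional α) a k ⊓ hankelKer ψ b k =
        (blockKer a (k - r) (r - b) (seqEval (a + k - 1) u α)).map (combine v w) := by
      ext x
      simp only [Submodule.mem_inf, Submodule.mem_map]
      constructor
      · rintro ⟨h1, h2⟩
        rw [hk] at h2
        obtain ⟨z, hz, rfl⟩ := h2
        refine ⟨z, mem_blockKer.2 ⟨hz, fun i hi => ?_⟩, rfl⟩
        rw [hval z hz i hi]
        exact (mem_hankelKer.1 h1).2 i hi
      · rintro ⟨z, hz, rfl⟩
        rw [mem_blockKer] at hz
        have h2 : combine v w z ∈ hankelKer ψ b k := by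
          rw [hk]
          exact ⟨z, hz.1, rfl⟩
        refine ⟨mem_hankelKer.2 ⟨(mem_hankelKer.1 h2).1, fun i hi => ?_⟩, h2⟩
        rw [← hval z hz.1 i hi]
        exact hz.2 i hi
    rw [hmap, ← LinearMap.range_domRestrict]
    exact LinearMap.finrank_range_of_inj
      (LinearMap.injective_domRestrict_iff.2 (hdisj.mono_left hle))
  simp_rw [hfin]
  rw [card_seqEval hlin hmem (fun γ => Module.finrank F (blockKer a (k - r) (r - b) γ) = n),
    blockCount, Fintype.card_sum, Fintype.card_fin, Fintype.card_fin]
  congr 2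
  rw [hB]
  split_ifs <;> omega

/-- The largest `r` for which the kernel of the `(M - r) × r` Hankel matrix vanishes. -/
noncomputable def hankelType (φ : F[X] →ₗ[F] F) (M : ℕ) : ℕ :=
  open Classical in Nat.findGreatest (fun y => hankelKer φ (M - y) y = ⊥) M

theorem le_hankelType_iff {φ : F[X] →ₗ[F] F} {M y : ℕ} (hy : y ≤ M) :
    y ≤ hankelType φ M ↔ hankelKer φ (M - y) y = ⊥ := by
  classical
  refine ⟨fun h => ?_, fun h => Nat.le_findGreatest hy h⟩
  have h0 : hankelKer φ (M - 0) 0 = ⊥ := by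
    rw [eq_bot_iff]
    intro v hv
    simpa [mem_degreeLT] using (mem_hankelKer.1 hv).1
  have h1 : hankelKer φ (M - hankelType φ M) (hankelType φ M) = ⊥ := by
    have := Nat.findGreatest_spec (P := fun y => hankelKer φ (M - y) y = ⊥) (Nat.zero_le M) h0
    rw [hankelType]
    convert this
  exact le_bot_iff.1 (h1 ▸ hankelKer_mono φ (by omega) h)

theorem isHankelType_hankelType (φ : F[X] →ₗ[F] F) {M : ℕ} (hM : 0 < M) :
    IsHankelType φ M (hankelType φ M) := by
  have hle : hankelType φ M ≤ M := by
    classical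
    exact Nat.findGreatest_le M
  have hlt : hankelType φ M < M := by
    refine lt_of_le_of_ne hle fun heq => ?_
    have h1 := (le_hankelType_iff (φ := φ) le_rfl).1 heq.ge
    have h2 : (1 : F[X]) ∈ hankelKer φ (M - M) M := by
      rw [mem_hankelKer, mem_degreeLT, degree_one]
      exact ⟨by exact_mod_cast hM, fun i hi => by omega⟩
    rw [h1, Submodule.mem_bot] at h2
    exact one_ne_zero h2
  exact ⟨hlt, (le_hankelType_iff hle).1 le_rfl, fun h => by
    have := (le_hankelType_iff (φ := φ) (M := M) (by omega)).2 h
    omega⟩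

theorem card_mul_card_hankelKer [Finite F] (φ : F[X] →ₗ[F] F) {M y : ℕ} (hy : 2 * (y + 1) ≤ M) :
    Nat.card F * Nat.card (hankelKer φ (M - y) y) =
      Nat.card (hankelKer φ (M - (y + 1)) (y + 1)) +
        open Classical in if y + 1 ≤ hankelType φ M then Nat.card F - 1 else 0 := by
  have h := isHankelType_hankelType φ (M := M) (by omega)
  have hr := h.two_mul_le
  have hq : 0 < Nat.card F := Nat.card_pos
  split_ifs with hle
  · rw [(le_hankelType_iff (by omega)).1 hle,
      (le_hankelType_iff (y := y) (by omega)).1 (by omega)]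
    simp only [Nat.card_unique]
    omega
  · rw [Module.natCard_eq_pow_finrank (K := F) (V := hankelKer φ (M - y) y),
      Module.natCard_eq_pow_finrank (K := F) (V := hankelKer φ (M - (y + 1)) (y + 1)),
      h.finrank_mid (by omega) (by omega), h.finrank_mid (by omega) (by omega), add_zero,
      ← pow_succ']
    congr 1
    omega

theorem linearIndependent_X_pow_mul {v : F[X]} (hv : v ≠ 0) (x : ℕ) :
    LinearIndependent F (fun i : Fin x => X ^ (i : ℕ) * v) := by
  have hdisj : Disjoint (degreeLTProd F x 0) (LinearMap.ker (combine v 0)) := by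
    rw [Submodule.disjoint_def]
    rintro ⟨p, q⟩ ⟨-, hq⟩ h
    have hq0 : q = 0 := by simpa [mem_degreeLT] using hq
    have hp0 : p = 0 := by simpa [hv] using h
    rw [hp0, hq0, Prod.mk_zero_zero]
  have := (linearIndependent_combine (A := x) (B := 0) hdisj le_rfl le_rfl).comp Sum.inl
    Sum.inl_injective
  simpa [Function.comp_def, mul_comm] using this

theorem card_seq_mem_hankelKer [Finite F] {n y : ℕ} (hy : y ≤ n + 1) {v : F[X]} (hv : v ≠ 0)
    (hvy : v ∈ degreeLT F y) :
    Nat.card {c : Fin n → F // v ∈ hankelKer (seqFunctional c) (n + 1 - y) y} =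
      Nat.card F ^ (y - 1) := by
  have hmem : ∀ i : Fin (n + 1 - y), X ^ (i : ℕ) * v ∈ degreeLT F n := fun i =>
    X_pow_mul_mem_degreeLT_s12 hvy (by omega)
  have h := card_seqEval (linearIndependent_X_pow_mul hv (n + 1 - y)) hmem (fun γ => γ = 0)
  have hy0 : y ≠ 0 := by
    rintro rfl
    exact hv (by simpa [mem_degreeLT] using hvy)
  have h1 : Nat.card {γ : Fin (n + 1 - y) → F // γ = 0} = 1 := Nat.card_unique
  rw [Fintype.card_fin, show n - (n + 1 - y) = y - 1 by omega, h1, mul_one] at h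
  rw [← h]
  refine Nat.card_congr (Equiv.subtypeEquivRight fun c => ?_)
  rw [mem_hankelKer, funext_iff]
  exact ⟨fun h i => h.2 i i.2, fun h => ⟨hvy, fun i hi => h ⟨i, hi⟩⟩⟩

instance [Finite F] (n : ℕ) : Finite (degreeLT F n) := Module.finite_of_finite F

instance [Finite F] (φ : F[X] →ₗ[F] F) (x y : ℕ) : Finite (hankelKer φ x y) :=
  Module.finite_of_finite F

theorem sum_card_hankelKer [Fintype F] {n y : ℕ} (hy : y ≤ n + 1) :
    Nat.card F * ∑ c : Fin n → F, Nat.card (hankelKer (seqFunctional c) (n + 1 - y) y) +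
      Nat.card F ^ y = Nat.card F ^ (n + 1) + Nat.card F ^ (2 * y) := by
  classical
  have := Fintype.ofFinite (degreeLT F y)
  have hswap : ∑ c : Fin n → F, Nat.card (hankelKer (seqFunctional c) (n + 1 - y) y) =
      ∑ v : degreeLT F y,
        Nat.card {c : Fin n → F // (v : F[X]) ∈ hankelKer (seqFunctional c) (n + 1 - y) y} := by
    rw [← Nat.card_sigma, ← Nat.card_sigma]
    exact Nat.card_congr
      { toFun := fun z => ⟨⟨z.2, (mem_hankelKer.1 z.2.2).1⟩, ⟨z.1, z.2.2⟩⟩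
        invFun := fun z => ⟨z.2, ⟨z.1, z.2.2⟩⟩
        left_inv := fun z => rfl
        right_inv := fun z => rfl }
  have hcard : (Finset.univ.erase (0 : degreeLT F y)).card + 1 = Nat.card F ^ y := by
    rw [Finset.card_erase_add_one (Finset.mem_univ _), Finset.card_univ, ← Nat.card_eq_fintype_card,
      Module.natCard_eq_pow_finrank (K := F), finrank_degreeLT]
  have hzero : Nat.card {c : Fin n → F // ((0 : degreeLT F y) : F[X]) ∈
      hankelKer (seqFunctional c) (n + 1 - y) y} = Nat.card F ^ n := by
    simp [Nat.card_eq_fintype_card]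
  have hne : ∀ v ∈ Finset.univ.erase (0 : degreeLT F y),
      Nat.card {c : Fin n → F // (v : F[X]) ∈ hankelKer (seqFunctional c) (n + 1 - y) y} =
        Nat.card F ^ (y - 1) := fun v hv =>
    card_seq_mem_hankelKer hy (by simpa using (Finset.mem_erase.1 hv).1) v.2
  rw [hswap, ← Finset.add_sum_erase _ _ (Finset.mem_univ (0 : degreeLT F y)), hzero,
    Finset.sum_congr rfl hne, Finset.sum_const, smul_eq_mul]
  rcases Nat.eq_zero_or_pos y with rfl | hy0
  · rw [pow_zero] at hcard
    rw [show (Finset.univ.erase (0 : degreeLT F 0)).card = 0 by omega]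
    ring
  · obtain ⟨z, rfl⟩ : ∃ z, y = z + 1 := ⟨y - 1, by omega⟩
    rw [Nat.add_sub_cancel]
    calc _ = Nat.card F ^ (n + 1) + Nat.card F ^ (z + 1) *
        ((Finset.univ.erase (0 : degreeLT F (z + 1))).card + 1) := by ring
      _ = _ := by rw [hcard]; ring

/-- The number of sequences of length `n` whose Hankel type is at least `y`. -/
noncomputable def typeGeCount (F : Type*) [Field F] (n y : ℕ) : ℕ :=
  Nat.card {c : Fin n → F // y ≤ hankelType (seqFunctional c) (n + 1)}

/-- The number of sequences of length `n` of Hankel type `r`. -/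
noncomputable def typeCount (F : Type*) [Field F] (n r : ℕ) : ℕ :=
  Nat.card {c : Fin n → F // hankelType (seqFunctional c) (n + 1) = r}

theorem typeCount_add_typeGeCount [Finite F] (n r : ℕ) :
    typeCount F n r + typeGeCount F n (r + 1) = typeGeCount F n r := by
  classical
  have := Fintype.ofFinite F
  simp only [typeCount, typeGeCount, Nat.card_eq_fintype_card, Fintype.card_subtype]
  rw [← Finset.card_union_of_disjoint]
  · congr 1
    ext c
    simp only [Finset.mem_union, Finset.mem_filter, Finset.mem_univ, true_and]
    omega
  · rw [Finset.disjoint_filter]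
    intro c _ h1 h2
    omega

theorem typeGeCount_eq_zero {n y : ℕ} (h : n + 1 < 2 * y) : typeGeCount F n y = 0 := by
  rw [typeGeCount, Nat.card_eq_zero]
  refine Or.inl ⟨fun ⟨c, hc⟩ => ?_⟩
  have := (isHankelType_hankelType (seqFunctional c) (M := n + 1) (by omega)).two_mul_le
  omega

theorem typeGeCount_succ_add [Finite F] {n y : ℕ} (h : 2 * (y + 1) ≤ n + 1) :
    typeGeCount F n (y + 1) + Nat.card F ^ (2 * y) = Nat.card F ^ n := by
  classical
  have := Fintype.ofFinite F
  have hq : 1 < Nat.card F := Finite.one_lt_card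
  have h1 := sum_card_hankelKer (F := F) (n := n) (y := y) (by omega)
  have h2 := sum_card_hankelKer (F := F) (n := n) (y := y + 1) (by omega)
  have hD : typeGeCount F n (y + 1) = (Finset.univ.filter fun c : Fin n → F =>
      y + 1 ≤ hankelType (seqFunctional c) (n + 1)).card := by
    rw [typeGeCount, Nat.card_eq_fintype_card, Fintype.card_subtype]
  have h3 : Nat.card F * ∑ c : Fin n → F, Nat.card (hankelKer (seqFunctional c) (n + 1 - y) y) =
      ∑ c : Fin n → F, Nat.card (hankelKer (seqFunctional c) (n + 1 - (y + 1)) (y + 1)) +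
        typeGeCount F n (y + 1) * (Nat.card F - 1) := by
    rw [Finset.mul_sum, Finset.sum_congr rfl fun c _ => card_mul_card_hankelKer (seqFunctional c) h,
      Finset.sum_add_distrib, ← Finset.sum_filter, Finset.sum_const, smul_eq_mul, hD]
  rw [h3] at h1
  obtain ⟨q, hqq⟩ : ∃ q, Nat.card F = q + 2 := ⟨Nat.card F - 2, by omega⟩
  rw [hqq, show q + 2 - 1 = q + 1 by omega] at h1
  rw [hqq] at h2 ⊢
  generalize ∑ c : Fin n → F, Nat.card (hankelKer (seqFunctional c) (n + 1 - (y + 1)) (y + 1)) = S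
    at h1 h2
  generalize typeGeCount F n (y + 1) = D at h1 ⊢
  have hpos : 0 < (q + 2) * (q + 1) := by positivity
  apply Nat.eq_of_mul_eq_mul_left hpos
  zify at h1 h2 ⊢
  linear_combination ((q : ℤ) + 2) * h1 - h2

theorem typeGeCount_add_two [Finite F] (n y : ℕ) :
    typeGeCount F (n + 2) (y + 2) = Nat.card F ^ 2 * typeGeCount F n (y + 1) := by
  rcases Nat.lt_or_ge (n + 1) (2 * (y + 1)) with h | h
  · rw [typeGeCount_eq_zero h, typeGeCount_eq_zero (by omega), mul_zero]
  · have h1 := typeGeCount_succ_add (F := F) h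
    have h2 := typeGeCount_succ_add (F := F) (n := n + 2) (y := y + 1) (by omega)
    zify at h1 h2 ⊢
    linear_combination h2 - (Nat.card F : ℤ) ^ 2 * h1

theorem typeCount_add_two [Finite F] (n r : ℕ) :
    typeCount F (n + 2) (r + 2) = Nat.card F ^ 2 * typeCount F n (r + 1) := by
  have h1 := typeCount_add_typeGeCount (F := F) n (r + 1)
  have h2 := typeCount_add_typeGeCount (F := F) (n + 2) (r + 2)
  rw [typeGeCount_add_two, typeGeCount_add_two] at h2
  zify at h1 h2 ⊢
  linear_combination h2 - (Nat.card F : ℤ) ^ 2 * h1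

/-- The number of pairs of sequences whose stacked `a × k` and `b × k` Hankel matrices have
nullity `n`. -/
noncomputable def nullityCount (F : Type*) [Field F] (a b k n : ℕ) : ℕ :=
  Nat.card {p : (Fin (a + k - 1) → F) × (Fin (b + k - 1) → F) //
    Module.finrank F
      ↥(hankelKer (seqFunctional p.1) a k ⊓ hankelKer (seqFunctional p.2) b k) = n}

theorem nullityCount_comm (a b k n : ℕ) : nullityCount F a b k n = nullityCount F b a k n := by
  refine Nat.card_congr (Equiv.subtypeEquiv (Equiv.prodComm _ _) fun p => ?_)
  rw [inf_comm]
  rfl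

theorem nullityCount_eq_sum [Finite F] {a b k : ℕ} (n : ℕ) (hbk : b < k) (hab : a ≤ b + 1) :
    nullityCount F a b k n = ∑ r ∈ Finset.range (b + k), typeCount F (b + k - 1) r *
      (Nat.card F ^ (if r ≤ b then r else b + 1 - a) * blockCount F a (k - r) (r - b) n) := by
  classical
  have := Fintype.ofFinite F
  have hM : b + k - 1 + 1 = b + k := by omega
  have htype : ∀ c : Fin (b + k - 1) → F,
      IsHankelType (seqFunctional c) (b + k) (hankelType (seqFunctional c) (b + k)) := fun c =>
    isHankelType_hankelType _ (by omega)
  have h1 : nullityCount F a b k n = ∑ c : Fin (b + k - 1) → F,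
      Nat.card {α : Fin (a + k - 1) → F // Module.finrank F
        ↥(hankelKer (seqFunctional α) a k ⊓ hankelKer (seqFunctional c) b k) = n} := by
    rw [← Nat.card_sigma]
    exact Nat.card_congr
      { toFun := fun z => ⟨z.1.2, ⟨z.1.1, z.2⟩⟩
        invFun := fun z => ⟨(z.2, z.1), z.2.2⟩
        left_inv := fun z => rfl
        right_inv := fun z => rfl }
  rw [h1, ← Finset.sum_fiberwise_of_maps_to
    (t := Finset.range (b + k)) (g := fun c => hankelType (seqFunctional c) (b + k))
    fun c _ => Finset.mem_range.2 (htype c).lt]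
  refine Finset.sum_congr rfl fun r _ => ?_
  have hfib : ∀ c ∈ Finset.univ.filter
      (fun c : Fin (b + k - 1) → F => hankelType (seqFunctional c) (b + k) = r),
      Nat.card {α : Fin (a + k - 1) → F // Module.finrank F
        ↥(hankelKer (seqFunctional α) a k ⊓ hankelKer (seqFunctional c) b k) = n} =
      Nat.card F ^ (if r ≤ b then r else b + 1 - a) * blockCount F a (k - r) (r - b) n := by
    intro c hc
    have hc' := htype c
    rw [(Finset.mem_filter.1 hc).2] at hc'
    exact hc'.card_finrank_inf_eq hbk hab
  have hcnt : typeCount F (b + k - 1) r = (Finset.univ.filter fun c : Fin (b + k - 1) → F =>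
      hankelType (seqFunctional c) (b + k) = r).card := by
    rw [typeCount, hM, Nat.card_eq_fintype_card, Fintype.card_subtype]
  rw [Finset.sum_congr rfl hfib, Finset.sum_const, smul_eq_mul, hcnt]

theorem typeCount_eq_zero [Finite F] {n r : ℕ} (h : n + 1 < 2 * r) : typeCount F n r = 0 := by
  have h1 := typeCount_add_typeGeCount (F := F) n r
  rw [typeGeCount_eq_zero h] at h1
  omega

theorem nullityCount_succ [Finite F] {a b k n : ℕ} (hbk : b < k) (hab : a ≤ b + 1)
    (hn : n + a + 1 ≤ k) :
    nullityCount F a (b + 1) (k + 1) n = Nat.card F ^ 3 * nullityCount F a b k n := by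
  rw [nullityCount_eq_sum n (by omega) (by omega), nullityCount_eq_sum n hbk hab,
    show b + 1 + (k + 1) = b + k + 1 + 1 by omega, Finset.sum_range_succ',
    Finset.sum_range_succ, Finset.mul_sum]
  have h0 : blockCount F a (k + 1 - 0) (0 - (b + 1)) n = 0 := by
    rw [Nat.sub_zero, Nat.zero_sub]
    exact blockCount_eq_zero (by omega)
  rw [h0, mul_zero, mul_zero, add_zero, typeCount_eq_zero (r := b + k + 1) (by omega), zero_mul,
    add_zero]
  refine Finset.sum_congr rfl fun r _ => ?_
  rw [show k + 1 - (r + 1) = k - r by omega, show r + 1 - (b + 1) = r - b by omega]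
  rcases r with _ | r
  · rw [Nat.zero_sub, Nat.sub_zero, blockCount_eq_zero (by omega)]
    ring
  · rw [show b + k + 1 + 1 - 1 = b + k - 1 + 2 by omega, typeCount_add_two,
      show (if r + 1 + 1 ≤ b + 1 then r + 1 + 1 else b + 1 + 1 - a) =
        (if r + 1 ≤ b then r + 1 else b + 1 - a) + 1 by split_ifs <;> omega]
    ring

theorem hankel_eq_seqFunctional (a k : ℕ) (α : Fin (a + k - 1) → ZMod 2) :
    hankel a k α = Matrix.of fun (i : Fin a) (j : Fin k) =>
      seqFunctional α (X ^ ((i : ℕ) + j)) := by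
  ext i j
  have := i.isLt
  have := j.isLt
  exact (seqFunctional_X_pow α (by omega)).symm

theorem Gamma_eq_nullityCount {a b k i : ℕ} (hi : i ≤ k) :
    Gamma a b k i = nullityCount (ZMod 2) a b k (k - i) := by
  refine Nat.card_congr (Equiv.subtypeEquivRight fun p => ?_)
  have h := finrank_inf_add_rank_fromRows (seqFunctional p.1) (seqFunctional p.2) a b k
  rw [hankel_eq_seqFunctional, hankel_eq_seqFunctional]
  constructor <;> intro h' <;> omega

theorem Gamma_comm {a b k i : ℕ} (hi : i ≤ k) : Gamma a b k i = Gamma b a k i := by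
  rw [Gamma_eq_nullityCount hi, Gamma_eq_nullityCount hi, nullityCount_comm]

theorem Gamma_succ {a b k i : ℕ} (hab : a ≤ b + 1) (ha : a + 1 ≤ i) (hb : b + 1 ≤ i)
    (hi : i ≤ k) : Gamma a (b + 1) (k + 1) (i + 1) = 8 * Gamma a b k i := by
  rw [Gamma_eq_nullityCount hi, Gamma_eq_nullityCount (by omega), Nat.add_sub_add_right,
    nullityCount_succ (by omega) hab (by omega), Nat.card_zmod]
  norm_num

theorem Gamma_add_right {s k i : ℕ} (hs : s + 1 ≤ i) (hi : i ≤ k) (m : ℕ) :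
    Gamma s (s + m) (k + m) (i + m) = 8 ^ m * Gamma s s k i := by
  induction m with
  | zero => simp
  | succ m ih =>
    rw [← add_assoc, ← add_assoc, ← add_assoc,
      Gamma_succ (by omega) (by omega) (by omega) (by omega), ih]
    ring

theorem Gamma_add_diag {t k i : ℕ} (ht : t + 1 ≤ i) (hi : i ≤ k) (j : ℕ) :
    Gamma (t + j) (t + j) (k + 2 * j) (i + 2 * j) = 8 ^ (2 * j) * Gamma t t k i := by
  induction j with
  | zero => simp
  | succ j ih =>
    rw [← add_assoc, show k + 2 * (j + 1) = k + 2 * j + 1 + 1 by ring,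
      show i + 2 * (j + 1) = i + 2 * j + 1 + 1 by ring,
      Gamma_succ le_rfl (by omega) (by omega) (by omega), Gamma_comm (by omega),
      Gamma_succ (by omega) (by omega) (by omega) (by omega), ih]
    ring

end HankelKernel

theorem Gamma_reduction_high (s m k j : ℕ) (hs : 2 ≤ s) (hj : j ≤ s - 1)
    (hk : s + m + 1 + j ≤ k) :
    Gamma s (s + m) k (s + m + 1 + j) =
      8 ^ (2 * j + m) * Gamma (s - j) (s - j) (k - m - 2 * j) (s - j + 1) := by
  have h1 := Gamma_add_right (s := s) (k := k - m) (i := s + 1 + j) (by omega) (by omega) m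
  have h2 := Gamma_add_diag (t := s - j) (k := k - m - 2 * j) (i := s - j + 1) (by omega)
    (by omega) j
  rw [show k - m + m = k by omega, show s + 1 + j + m = s + m + 1 + j by omega] at h1
  rw [show s - j + j = s by omega, show k - m - 2 * j + 2 * j = k - m by omega,
    show s - j + 1 + 2 * j = s + 1 + j by omega] at h2
  rw [h1, h2]
  ring
end
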